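/- arXiv:1711.00776 — 3 statements merged into one kernel-verified Lean document; each statement's English description precedes it below -/
import Mathlib

section
/- Let v ∈ C⁴(ℝ) be a solution of the ODE v'''' − A·v'' − f(v) = 0 on ℝ. Then inf_{t ∈ ℝ} |v(t)| ≤ a₀, and equality holds if and only if v is a non-zero constant, i.e. v ≡ a₀ or v ≡ −a₀. -/
open Real Filter

namespace Paper

/-- The coefficient `A = (n(n-4)+8)/2`. -/
noncomputable def A (n : ℕ) : ℝ := ((n : ℝ) * ((n : ℝ) - 4) + 8) / 2

/-- The coefficient `B = n²(n-4)²/16`. -/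
noncomputable def B (n : ℕ) : ℝ := (n : ℝ) ^ 2 * ((n : ℝ) - 4) ^ 2 / 16

/-- The exponent `p = (n+4)/(n-4)`. -/
noncomputable def p (n : ℕ) : ℝ := ((n : ℝ) + 4) / ((n : ℝ) - 4)

/-- The nonlinearity `f(v) = |v|^(p-1) v - B v`. -/
noncomputable def f (n : ℕ) (v : ℝ) : ℝ := |v| ^ (p n - 1) * v - B n * v

/-- The constant `a₀ = (n(n-4)/4)^((n-4)/4)`. -/
noncomputable def a₀ (n : ℕ) : ℝ := ((n : ℝ) * ((n : ℝ) - 4) / 4) ^ (((n : ℝ) - 4) / 4)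

/-- The constant `c_n = ((n-4)(n-2)n(n+2))^((n-4)/8)`. -/
noncomputable def c (n : ℕ) : ℝ :=
  (((n : ℝ) - 4) * ((n : ℝ) - 2) * (n : ℝ) * ((n : ℝ) + 2)) ^ (((n : ℝ) - 4) / 8)

/-- The potential `F(v) = |v|^(p+1)/(p+1) - (B/2) v²`. -/
noncomputable def F (n : ℕ) (s : ℝ) : ℝ := |s| ^ (p n + 1) / (p n + 1) - B n / 2 * s ^ 2

/-- The energy `E_v(t) = -v''' v' + v''²/2 + (A/2) v'² + F(v)`. -/
noncomputable def E (n : ℕ) (v : ℝ → ℝ) (t : ℝ) : ℝ :=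
  -(iteratedDeriv 3 v t) * deriv v t + 1 / 2 * (iteratedDeriv 2 v t) ^ 2
    + A n / 2 * (deriv v t) ^ 2 + F n (v t)

end Paper

namespace Paper

theorem B_nonneg (n : ℕ) : 0 ≤ B n := by
  unfold B; positivity

theorem a₀_pos {n : ℕ} (hn : 5 ≤ n) : 0 < a₀ n := by
  have h : (5 : ℝ) ≤ n := by exact_mod_cast hn
  unfold a₀
  apply rpow_pos_of_pos
  have : (0 : ℝ) < (n : ℝ) - 4 := by linarith
  positivity

theorem p_sub_one_pos {n : ℕ} (hn : 5 ≤ n) : 0 < p n - 1 := by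
  have h : (5 : ℝ) ≤ n := by exact_mod_cast hn
  have h4 : (0 : ℝ) < (n : ℝ) - 4 := by linarith
  have : p n - 1 = 8 / ((n : ℝ) - 4) := by unfold p; field_simp; ring
  rw [this]; positivity

theorem a₀_rpow {n : ℕ} (hn : 5 ≤ n) : a₀ n ^ (p n - 1) = B n := by
  have h : (5 : ℝ) ≤ n := by exact_mod_cast hn
  have h4 : (0 : ℝ) < (n : ℝ) - 4 := by linarith
  have h1 : p n - 1 = 8 / ((n : ℝ) - 4) := by unfold p; field_simp; ring
  have h2 : ((n : ℝ) - 4) / 4 * (8 / ((n : ℝ) - 4)) = (2 : ℕ) := by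
    push_cast; field_simp; norm_num
  rw [h1, a₀, ← rpow_mul (by positivity), h2, rpow_natCast, B]
  ring

theorem f_neg (n : ℕ) (x : ℝ) : f n (-x) = -f n x := by
  unfold f; rw [abs_neg]; ring

theorem f_eq_of_pos (n : ℕ) {x : ℝ} (hx : 0 < x) : f n x = (x ^ (p n - 1) - B n) * x := by
  unfold f; rw [abs_of_pos hx]; ring

theorem f_nonneg {n : ℕ} (hn : 5 ≤ n) {x : ℝ} (hx : a₀ n ≤ x) : 0 ≤ f n x := by
  have h0 := a₀_pos hn
  rw [f_eq_of_pos n (h0.trans_le hx), ← a₀_rpow hn]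
  have := rpow_le_rpow h0.le hx (p_sub_one_pos hn).le
  exact mul_nonneg (by linarith) (by linarith)

theorem f_pos {n : ℕ} (hn : 5 ≤ n) {x : ℝ} (hx : a₀ n < x) : 0 < f n x := by
  have h0 := a₀_pos hn
  rw [f_eq_of_pos n (h0.trans hx), ← a₀_rpow hn]
  have := rpow_lt_rpow h0.le hx (p_sub_one_pos hn)
  exact mul_pos (by linarith) (by linarith)

theorem continuous_f {n : ℕ} (hn : 5 ≤ n) : Continuous (f n) := by
  unfold f
  have := (continuous_abs (G := ℝ)).rpow_const
    (fun x => Or.inr (p_sub_one_pos hn).le : ∀ x : ℝ, |x| ≠ 0 ∨ 0 ≤ p n - 1)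
  fun_prop

/-- The superlinear nonlinearity absorbs the linear term weighted by a lower power of the
cutoff `s`, up to an additive constant. -/
theorem exists_mul_pow_le {n : ℕ} (hn : 5 ≤ n) :
    ∃ K : ℝ, 0 ≤ K ∧ ∀ x s : ℝ, a₀ n ≤ x → 0 ≤ s → s ≤ 1 →
      x * s ^ (n - 4) ≤ K + 2 * (f n x * s ^ (n + 4)) := by
  have hp := p_sub_one_pos hn
  have hB := B_nonneg n
  set L := (2 * B n) ^ (p n - 1)⁻¹ with hL
  have hL0 : 0 ≤ L := by positivity
  refine ⟨L + 1, by positivity, fun x s hx hs hs1 => ?_⟩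
  have hx0 : 0 < x := (a₀_pos hn).trans_le hx
  have hf := f_nonneg hn hx
  have hfs : 0 ≤ f n x * s ^ (n + 4) := by positivity
  have hsm : s ^ (n - 4) ≤ 1 := pow_le_one₀ hs hs1
  have hy0 : 0 ≤ x * s ^ (n - 4) := by positivity
  rcases le_total x L with h | h
  · have : x * s ^ (n - 4) ≤ x := mul_le_of_le_one_right hx0.le hsm
    linarith
  rcases le_total (x * s ^ (n - 4)) 1 with h1 | h1
  · linarith
  have hxB : 2 * B n ≤ x ^ (p n - 1) := by
    calc 2 * B n = L ^ (p n - 1) := by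
          rw [hL, ← rpow_mul (by positivity), inv_mul_cancel₀ hp.ne', rpow_one]
      _ ≤ _ := rpow_le_rpow hL0 h hp.le
  have hxf : x ^ p n ≤ 2 * f n x := by
    have : x ^ p n = x ^ (p n - 1) * x := by
      conv_lhs => rw [← sub_add_cancel (p n) 1]
      rw [rpow_add hx0, rpow_one]
    rw [f_eq_of_pos n hx0, this]
    nlinarith
  have hpow : (s ^ (n - 4)) ^ p n = s ^ (n + 4) := by
    have h5 : (5 : ℝ) ≤ n := by exact_mod_cast hn
    have h4 : (n : ℝ) - 4 ≠ 0 := by linarith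
    rw [← rpow_natCast, ← rpow_mul hs, ← rpow_natCast]
    congr 1
    rw [Nat.cast_sub (by omega), p]
    push_cast
    field_simp
  have hy : x * s ^ (n - 4) ≤ x ^ p n * s ^ (n + 4) := by
    calc x * s ^ (n - 4) = (x * s ^ (n - 4)) ^ (1 : ℝ) := (rpow_one _).symm
      _ ≤ (x * s ^ (n - 4)) ^ p n := rpow_le_rpow_of_exponent_le h1 (by linarith)
      _ = _ := by rw [mul_rpow hx0.le (by positivity), hpow]
  have : x ^ p n * s ^ (n + 4) ≤ 2 * f n x * s ^ (n + 4) := by gcongr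
  linarith

end Paper

open Polynomial in
/-- Derivatives of a power of `1 - X ^ 2` are controlled on `[-1, 1]` by a lower power. -/
theorem exists_abs_iterate_derivative_le {j k l : ℕ} (h : l ≤ k - j) :
    ∃ C : ℝ, 0 ≤ C ∧ ∀ x : ℝ, |x| ≤ 1 →
      |(derivative^[j] ((1 - X ^ 2 : ℝ[X]) ^ k)).eval x| ≤ C * (1 - x ^ 2) ^ l := by
  obtain ⟨q, hq⟩ := (pow_dvd_pow (1 - X ^ 2 : ℝ[X]) h).trans
    (pow_sub_dvd_iterate_derivative_pow (1 - X ^ 2 : ℝ[X]) k j)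
  obtain ⟨C, hC⟩ := (isCompact_Icc (a := (-1 : ℝ)) (b := 1)).exists_bound_of_continuousOn
    q.continuous.continuousOn
  refine ⟨max C 0, le_max_right _ _, fun x hx => ?_⟩
  have h0 : 0 ≤ 1 - x ^ 2 := by nlinarith [sq_abs x, abs_nonneg x]
  have hb : |q.eval x| ≤ max C 0 := (hC x (abs_le.mp hx)).trans (le_max_left _ _)
  rw [hq, eval_mul, abs_mul, mul_comm]
  simp only [eval_pow, eval_sub, eval_one, eval_X]
  rw [abs_of_nonneg (pow_nonneg h0 l)]
  gcongr

/-- Lagrange's identity for the formally self-adjoint operator `D ^ 4 - a * D ^ 2`. -/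
theorem hasDerivAt_lagrange (a x : ℝ) (u φ : ℕ → ℝ → ℝ)
    (hu : ∀ j < 4, HasDerivAt (u j) (u (j + 1) x) x)
    (hφ : ∀ j < 4, HasDerivAt (φ j) (φ (j + 1) x) x) :
    HasDerivAt (fun y => u 3 y * φ 0 y - u 2 y * φ 1 y + u 1 y * φ 2 y - u 0 y * φ 3 y
        - a * (u 1 y * φ 0 y - u 0 y * φ 1 y))
      ((u 4 x - a * u 2 x) * φ 0 x - u 0 x * (φ 4 x - a * φ 2 x)) x := by
  have u0 := hu 0 (by norm_num)
  have u1 := hu 1 (by norm_num)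
  have u2 := hu 2 (by norm_num)
  have u3 := hu 3 (by norm_num)
  have φ0 := hφ 0 (by norm_num)
  have φ1 := hφ 1 (by norm_num)
  have φ2 := hφ 2 (by norm_num)
  have φ3 := hφ 3 (by norm_num)
  refine (((((u3.mul φ0).sub (u2.mul φ1)).add (u1.mul φ2)).sub (u0.mul φ3)).sub
    (((u1.mul φ0).sub (u0.mul φ1)).const_mul a)).congr_deriv ?_
  ring

theorem ContDiff.hasDerivAt_iteratedDeriv {v : ℝ → ℝ} {k j : ℕ} (hv : ContDiff ℝ k v)
    (hj : j < k) (x : ℝ) : HasDerivAt (iteratedDeriv j v) (iteratedDeriv (j + 1) v x) x := by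
  rw [iteratedDeriv_succ]
  exact (hv.differentiable_iteratedDeriv j (by exact_mod_cast hj) x).hasDerivAt

namespace Paper

open Polynomial in
/-- A weighted form of the equation on `[t₀ - R, t₀ + R]`: there is a function whose total
increment is of order `1 / R` and whose derivative dominates `f (v)` times a cutoff. -/
theorem exists_monotone_quantity {n : ℕ} (hn : 5 ≤ n) {v : ℝ → ℝ} (hreg : ContDiff ℝ 4 v)
    (hode : ∀ t : ℝ, iteratedDeriv 4 v t - A n * iteratedDeriv 2 v t - f n (v t) = 0)
    (hv : ∀ t, a₀ n ≤ v t) (t₀ : ℝ) :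
    ∃ R₀ M : ℝ, 0 < R₀ ∧ 0 ≤ M ∧ ∀ R : ℝ, R₀ ≤ R → ∃ H H' : ℝ → ℝ,
      (∀ x, HasDerivAt H (H' x) x) ∧ H (t₀ + R) - H (t₀ - R) = M / R ∧
      ∀ x, |x - t₀| ≤ R → f n (v x) * (1 - ((x - t₀) / R) ^ 2) ^ (n + 4) / 2 ≤ H' x := by
  obtain ⟨K, hK, hKle⟩ := exists_mul_pow_le hn
  set P : ℝ[X] := (1 - X ^ 2) ^ (n + 4) with hP
  obtain ⟨C₂, hC₂, hle₂⟩ :=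
    exists_abs_iterate_derivative_le (j := 2) (k := n + 4) (l := n - 4) (by omega)
  obtain ⟨C₄, hC₄, hle₄⟩ :=
    exists_abs_iterate_derivative_le (j := 4) (k := n + 4) (l := n - 4) (by omega)
  set C := C₄ + |A n| * C₂ with hC
  have hC0 : 0 ≤ C := by positivity
  refine ⟨1 + 4 * C, 2 * (C * K), by positivity, by positivity, fun R hR => ?_⟩
  have hR1 : 1 ≤ R := by linarith
  have hR0 : 0 < R := by linarith
  set φ : ℕ → ℝ → ℝ := fun j x => (derivative^[j] P).eval ((x - t₀) / R) / R ^ j with hφ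
  have hφd : ∀ j x, HasDerivAt (φ j) (φ (j + 1) x) x := by
    intro j x
    have h1 : HasDerivAt (fun x : ℝ => (x - t₀) / R) (1 / R) x :=
      ((hasDerivAt_id x).sub_const t₀).div_const R
    have h2 := (((derivative^[j] P).hasDerivAt ((x - t₀) / R)).comp x h1).div_const (R ^ j)
    simp only [hφ, Function.iterate_succ_apply']
    refine h2.congr_deriv ?_
    field_simp
    ring
  have hφ0 : ∀ j < 4, φ j (t₀ + R) = 0 ∧ φ j (t₀ - R) = 0 := by
    intro j hj
    obtain ⟨c, -, hc⟩ :=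
      exists_abs_iterate_derivative_le (j := j) (k := n + 4) (l := 1) (by omega)
    have e1 : (t₀ + R - t₀) / R = 1 := by field_simp; ring
    have e2 : (t₀ - R - t₀) / R = -1 := by field_simp; ring
    have h1 := hc 1 (by norm_num)
    have h2 := hc (-1) (by norm_num)
    norm_num at h1 h2
    simp only [hφ, e1, e2, hP]
    simp [h1, h2]
  set G : ℝ → ℝ := fun y => iteratedDeriv 3 v y * φ 0 y - iteratedDeriv 2 v y * φ 1 y
    + iteratedDeriv 1 v y * φ 2 y - iteratedDeriv 0 v y * φ 3 y
    - A n * (iteratedDeriv 1 v y * φ 0 y - iteratedDeriv 0 v y * φ 1 y) with hG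
  have hGd := fun x => hasDerivAt_lagrange (A n) x (fun j => iteratedDeriv j v) φ
    (fun j hj => hreg.hasDerivAt_iteratedDeriv (k := 4) hj x) (fun j _ => hφd j x)
  refine ⟨fun x => G x + C * K / R ^ 2 * x, _,
    fun x => (hGd x).add ((hasDerivAt_id x).const_mul (C * K / R ^ 2)), ?_, fun x hx => ?_⟩
  · have e1 : G (t₀ + R) = 0 := by simp [hG, hφ0]
    have e2 : G (t₀ - R) = 0 := by simp [hG, hφ0]
    simp only [e1, e2]
    field_simp
    ring
  · set y := (x - t₀) / R with hy
    have hy1 : |y| ≤ 1 := by rw [hy, abs_div, abs_of_pos hR0]; exact (div_le_one hR0).mpr hx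
    set s := 1 - y ^ 2 with hs
    have hs0 : 0 ≤ s := by nlinarith [sq_abs y, abs_nonneg y]
    have hs1 : s ≤ 1 := by nlinarith [sq_nonneg y]
    have hvx := hv x
    have hv0 : 0 < v x := (a₀_pos hn).trans_le hvx
    have hφx : φ 0 x = s ^ (n + 4) := by simp [hφ, hP, hs, hy]
    have hfs : 0 ≤ f n (v x) * s ^ (n + 4) :=
      mul_nonneg (f_nonneg hn hvx) (by positivity)
    have h4 : |φ 4 x| ≤ C₄ * s ^ (n - 4) / R ^ 2 := by
      simp only [hφ, abs_div, abs_of_pos (pow_pos hR0 4)]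
      exact div_le_div₀ (by positivity) (hle₄ y hy1) (by positivity)
        (pow_le_pow_right₀ hR1 (by norm_num))
    have h2 : |φ 2 x| ≤ C₂ * s ^ (n - 4) / R ^ 2 := by
      simp only [hφ, abs_div, abs_of_pos (pow_pos hR0 2)]
      exact div_le_div_of_nonneg_right (hle₂ y hy1) (by positivity)
    have hcomb : φ 4 x - A n * φ 2 x ≤ C / R ^ 2 * s ^ (n - 4) := by
      calc φ 4 x - A n * φ 2 x ≤ |φ 4 x| + |A n| * |φ 2 x| := by
            rw [← abs_mul]
            linarith [le_abs_self (φ 4 x), neg_abs_le (A n * φ 2 x)]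
        _ ≤ C₄ * s ^ (n - 4) / R ^ 2 + |A n| * (C₂ * s ^ (n - 4) / R ^ 2) := by gcongr
        _ = _ := by rw [hC]; ring
    have hδ : C / R ^ 2 ≤ 1 / 4 := by
      rw [div_le_iff₀ (by positivity)]
      nlinarith
    have hδ0 : 0 ≤ C / R ^ 2 := by positivity
    have hmain : v x * (φ 4 x - A n * φ 2 x)
        ≤ C / R ^ 2 * K + f n (v x) * s ^ (n + 4) / 2 := by
      calc v x * (φ 4 x - A n * φ 2 x) ≤ v x * (C / R ^ 2 * s ^ (n - 4)) := by gcongr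
        _ = C / R ^ 2 * (v x * s ^ (n - 4)) := by ring
        _ ≤ C / R ^ 2 * (K + 2 * (f n (v x) * s ^ (n + 4))) := by
            gcongr; exact hKle _ _ hvx hs0 hs1
        _ ≤ _ := by nlinarith
    have hf : iteratedDeriv 4 v x - A n * iteratedDeriv 2 v x = f n (v x) := by
      linarith [hode x]
    simp only [hf, hφx, iteratedDeriv_zero, mul_one]
    rw [mul_div_right_comm C K]
    linarith

/-- Liouville property: a global solution that stays above `a₀` is constant. -/
theorem eq_a₀_of_le {n : ℕ} (hn : 5 ≤ n) {v : ℝ → ℝ} (hreg : ContDiff ℝ 4 v)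
    (hode : ∀ t : ℝ, iteratedDeriv 4 v t - A n * iteratedDeriv 2 v t - f n (v t) = 0)
    (hv : ∀ t, a₀ n ≤ v t) (t₀ : ℝ) : v t₀ = a₀ n := by
  by_contra hne
  have hpos : 0 < f n (v t₀) := f_pos hn (lt_of_le_of_ne (hv t₀) (Ne.symm hne))
  obtain ⟨ε, hε, hεle⟩ : ∃ ε > 0, ∀ x, |x - t₀| ≤ ε → f n (v t₀) / 2 ≤ f n (v x) := by
    have hc : ContinuousAt (fun x => f n (v x)) t₀ :=
      ((continuous_f hn).comp hreg.continuous).continuousAt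
    have hev := hc.eventually (lt_mem_nhds (half_lt_self hpos))
    obtain ⟨ε, hε, h⟩ := Metric.eventually_nhds_iff_ball.mp hev
    refine ⟨ε / 2, by positivity, fun x hx => (h x ?_).le⟩
    rw [Metric.mem_ball, Real.dist_eq]
    linarith
  obtain ⟨R₀, M, hR₀, hM, hH⟩ := exists_monotone_quantity hn hreg hode hv t₀
  set κ := f n (v t₀) / 2 * (3 / 4) ^ (n + 4) / 2 with hκ
  have hκ0 : 0 < κ := by positivity
  set R := R₀ + 2 * ε + M / (κ * ε) with hRdef
  have hMκ : 0 ≤ M / (κ * ε) := by positivity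
  have hR0 : 0 < R := by positivity
  obtain ⟨H, H', hd, hincr, hlow⟩ := hH R (by linarith)
  have hbase : ∀ x, |x - t₀| ≤ R → 0 ≤ H' x := by
    intro x hx
    refine le_trans ?_ (hlow x hx)
    have hy : |(x - t₀) / R| ≤ 1 := by
      rw [abs_div, abs_of_pos hR0]; exact (div_le_one hR0).mpr hx
    have : 0 ≤ 1 - ((x - t₀) / R) ^ 2 := by
      nlinarith [sq_abs ((x - t₀) / R), abs_nonneg ((x - t₀) / R)]
    have := f_nonneg hn (hv x)
    positivity
  have hinner : ∀ x, |x - t₀| ≤ ε → κ ≤ H' x := by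
    intro x hx
    refine le_trans ?_ (hlow x (by linarith))
    have hy : |(x - t₀) / R| ≤ 1 / 2 := by
      rw [abs_div, abs_of_pos hR0, div_le_iff₀ hR0]; linarith
    have : 3 / 4 ≤ 1 - ((x - t₀) / R) ^ 2 := by
      nlinarith [sq_abs ((x - t₀) / R), abs_nonneg ((x - t₀) / R)]
    have := hεle x hx
    have := f_nonneg hn (hv x)
    rw [hκ]
    gcongr
  have hincr_le : ∀ c a b : ℝ, a ≤ b → (∀ x ∈ Set.Icc a b, c ≤ H' x) →
      c * (b - a) ≤ H b - H a := by
    intro c a b hab h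
    refine (convex_Icc a b).mul_sub_le_image_sub_of_le_deriv
      (fun x _ => (hd x).continuousAt.continuousWithinAt)
      (fun x _ => (hd x).differentiableAt.differentiableWithinAt)
      (fun x hx => ?_) a ⟨le_rfl, hab⟩ b ⟨hab, le_rfl⟩ hab
    rw [(hd x).deriv]
    exact h x (interior_subset hx)
  have h1 := hincr_le 0 (t₀ - R) (t₀ - ε) (by linarith) fun x hx =>
    hbase x (abs_le.mpr ⟨by linarith [hx.1], by linarith [hx.2]⟩)
  have h2 := hincr_le κ (t₀ - ε) (t₀ + ε) (by linarith) fun x hx =>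
    hinner x (abs_le.mpr ⟨by linarith [hx.1], by linarith [hx.2]⟩)
  have h3 := hincr_le 0 (t₀ + ε) (t₀ + R) (by linarith) fun x hx =>
    hbase x (abs_le.mpr ⟨by linarith [hx.1], by linarith [hx.2]⟩)
  have h4 : M / R ≤ κ * ε := by
    rw [div_le_iff₀ hR0, mul_comm, ← div_le_iff₀ (by positivity)]
    linarith
  have h5 : 0 < κ * ε := by positivity
  nlinarith

theorem eq_const_of_le_abs {n : ℕ} (hn : 5 ≤ n) {v : ℝ → ℝ} (hreg : ContDiff ℝ 4 v)
    (hode : ∀ t : ℝ, iteratedDeriv 4 v t - A n * iteratedDeriv 2 v t - f n (v t) = 0)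
    (hv : ∀ t, a₀ n ≤ |v t|) : v = (fun _ => a₀ n) ∨ v = (fun _ => -a₀ n) := by
  have h0 := a₀_pos hn
  have hne : ∀ t, v t ≠ 0 := fun t ht => by
    have := hv t
    rw [ht, abs_zero] at this
    linarith
  have hsign : (∀ t, 0 < v t) ∨ ∀ t, v t < 0 := by
    by_contra! h
    obtain ⟨⟨a, ha⟩, b, hb⟩ := h
    obtain ⟨t, ht⟩ := mem_range_of_exists_le_of_exists_ge hreg.continuous ⟨a, ha⟩ ⟨b, hb⟩
    exact hne t ht
  rcases hsign with h | h
  · left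
    funext t
    exact eq_a₀_of_le hn hreg hode (fun t => by simpa [abs_of_pos (h t)] using hv t) t
  · right
    funext t
    have hode' : ∀ t : ℝ, iteratedDeriv 4 (-v) t - A n * iteratedDeriv 2 (-v) t
        - f n ((-v) t) = 0 := by
      intro t
      rw [iteratedDeriv_neg, iteratedDeriv_neg, Pi.neg_apply, f_neg]
      linarith [hode t]
    have := eq_a₀_of_le hn hreg.neg hode'
      (fun t => by simpa [abs_of_neg (h t)] using hv t) t
    linarith

end Paper

/-- **Theorem 1 (i).** If `v ∈ C⁴(ℝ)` solves `v'''' - A v'' - f(v) = 0` on `ℝ`, then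
`inf_ℝ |v| ≤ a₀`, with equality iff `v` is a non-zero constant, i.e. `v ≡ a₀` or `v ≡ -a₀`. -/
theorem inf_le_a₀ (n : ℕ) (hn : 5 ≤ n) (v : ℝ → ℝ)
    (hreg : ContDiff ℝ 4 v)
    (hode : ∀ t : ℝ, iteratedDeriv 4 v t - Paper.A n * iteratedDeriv 2 v t
      - Paper.f n (v t) = 0) :
    (⨅ t : ℝ, |v t|) ≤ Paper.a₀ n ∧
      ((⨅ t : ℝ, |v t|) = Paper.a₀ n ↔
        v = (fun _ => Paper.a₀ n) ∨ v = (fun _ => -Paper.a₀ n)) := by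
  have hbdd : BddBelow (Set.range fun t => |v t|) :=
    ⟨0, by rintro _ ⟨t, rfl⟩; exact abs_nonneg _⟩
  have hle : Paper.a₀ n ≤ (⨅ t : ℝ, |v t|) →
      v = (fun _ => Paper.a₀ n) ∨ v = (fun _ => -Paper.a₀ n) := fun h =>
    Paper.eq_const_of_le_abs hn hreg hode fun t => h.trans (ciInf_le hbdd t)
  have heq : v = (fun _ => Paper.a₀ n) ∨ v = (fun _ => -Paper.a₀ n) →
      (⨅ t : ℝ, |v t|) = Paper.a₀ n := by
    rintro (h | h) <;> simp [h, abs_of_pos (Paper.a₀_pos hn)]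
  refine ⟨?_, fun h => hle h.ge, heq⟩
  by_contra! h
  exact h.ne' (heq (hle h.le))
end

section
/- Let a ∈ (0, a₀). Then there exists a bounded solution v ∈ C⁴(ℝ) of the ODE v'''' − A·v'' − f(v) = 0 with min_{t ∈ ℝ} v(t) = a such that: v is periodic with some minimal period L > 0; on each interval of length L, v has exactly one local maximum point and exactly one local minimum point; and v is symmetric with respect to each of its critical points, i.e. whenever v'(t₀) = 0 one has v(t₀ + t) = v(t₀ − t) for all t ∈ ℝ. -/
open Real Filter

section GlobalFlow

variable {X : Type*} [NormedAddCommGroup X] [NormedSpace ℝ X]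

/-- The primitive of a function dominated by `C * exp (c * |s|)` is dominated by
`C / c * exp (c * |t|)`. -/
theorem norm_integral_le_exp_abs {g : ℝ → X} {C c : ℝ} (hC : 0 ≤ C) (hc : 0 < c)
    (hg : ∀ s, ‖g s‖ ≤ C * exp (c * |s|)) (t : ℝ) :
    ‖∫ s in (0 : ℝ)..t, g s‖ ≤ C / c * exp (c * |t|) := by
  have key : ∀ (k : ℝ → X), (∀ s, ‖k s‖ ≤ C * exp (c * |s|)) → ∀ t, 0 ≤ t →
      ‖∫ s in (0 : ℝ)..t, k s‖ ≤ C / c * exp (c * |t|) := by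
    intro k hk t ht
    have h1 : ∀ s, HasDerivAt (fun s => C / c * exp (c * s)) (C * exp (c * s)) s := by
      intro s
      have := (((hasDerivAt_id s).const_mul c).exp).const_mul (C / c)
      refine this.congr_deriv ?_
      simp only [id]
      field_simp
    have hcont : Continuous fun s : ℝ => C * exp (c * s) := by fun_prop
    have h2 : ∫ s in (0 : ℝ)..t, C * exp (c * s) = C / c * exp (c * t) - C / c * exp (c * 0) :=
      intervalIntegral.integral_eq_sub_of_hasDerivAt (fun s _ => h1 s)
        (hcont.intervalIntegrable _ _)
    calc ‖∫ s in (0 : ℝ)..t, k s‖ ≤ ∫ s in (0 : ℝ)..t, C * exp (c * s) := by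
          refine intervalIntegral.norm_integral_le_of_norm_le ht ?_
            (hcont.intervalIntegrable _ _)
          refine MeasureTheory.ae_of_all _ fun s hs => ?_
          simpa [abs_of_pos hs.1] using hk s
      _ ≤ C / c * exp (c * |t|) := by
          rw [h2, abs_of_nonneg ht]
          have : 0 ≤ C / c * exp (c * 0) := by positivity
          linarith
  rcases le_total 0 t with ht | ht
  · exact key g hg t ht
  · have h := key (fun s => g (-s)) (fun s => by simpa using hg (-s)) (-t) (by linarith)
    rw [intervalIntegral.integral_comp_neg (fun s => g s)] at h
    rw [intervalIntegral.integral_symm, norm_neg]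
    simpa using h

/-- A globally Lipschitz autonomous vector field on a Banach space has a global integral curve
through every point. -/
theorem exists_global_integralCurve [CompleteSpace X] {V : X → X} {K : NNReal}
    (hV : LipschitzWith K V) (x₀ : X) :
    ∃ γ : ℝ → X, γ 0 = x₀ ∧ ∀ t, HasDerivAt γ (V (γ t)) t := by
  set k : ℝ := K + 1 with hk
  have hkpos : 0 < k := by positivity
  have hVk : ∀ x y, ‖V x - V y‖ ≤ k * ‖x - y‖ := fun x y => by
    have h := hV.dist_le_mul x y
    rw [dist_eq_norm, dist_eq_norm] at h
    have := norm_nonneg (x - y)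
    rw [hk]; linarith
  set w : ℝ → ℝ := fun t => exp (2 * k * |t|) with hw
  have hwc : Continuous w := by fun_prop
  have hwpos : ∀ t, 0 < w t := fun t => exp_pos _
  have hw1 : ∀ t, 1 ≤ w t := fun t => one_le_exp (by positivity)
  have hVc : Continuous V := hV.continuous
  have hint : ∀ Y : BoundedContinuousFunction ℝ X, Continuous fun s => V (w s • Y s) :=
    fun Y => hVc.comp (hwc.smul Y.continuous)
  have hprim : ∀ Y : BoundedContinuousFunction ℝ X,
      Continuous fun t => ∫ s in (0 : ℝ)..t, V (w s • Y s) := fun Y =>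
    intervalIntegral.continuous_primitive (fun _ _ => (hint Y).intervalIntegrable _ _) 0
  have hbd : ∀ Y : BoundedContinuousFunction ℝ X, ∀ t,
      ‖(w t)⁻¹ • (x₀ + ∫ s in (0 : ℝ)..t, V (w s • Y s))‖
        ≤ ‖x₀‖ + (‖V 0‖ + k * ‖Y‖) / (2 * k) := by
    intro Y t
    have h1 : ‖∫ s in (0 : ℝ)..t, V (w s • Y s)‖
        ≤ (‖V 0‖ + k * ‖Y‖) / (2 * k) * w t := by
      refine norm_integral_le_exp_abs (g := fun s => V (w s • Y s)) (by positivity)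
        (by positivity) (fun s => ?_) t
      have h2 := hVk (w s • Y s) 0
      have h3 : ‖V (w s • Y s)‖ ≤ ‖V 0‖ + ‖V (w s • Y s) - V 0‖ := norm_le_insert' _ _
      have h4 : ‖w s • Y s‖ ≤ w s * ‖Y‖ := by
        rw [norm_smul, Real.norm_of_nonneg (hwpos s).le]
        exact mul_le_mul_of_nonneg_left (Y.norm_coe_le_norm s) (hwpos s).le
      rw [sub_zero] at h2
      have h5 : k * ‖w s • Y s‖ ≤ k * (w s * ‖Y‖) := by gcongr
      have h6 : ‖V 0‖ * 1 ≤ ‖V 0‖ * w s := by gcongr; exact hw1 s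
      change _ ≤ (‖V 0‖ + k * ‖Y‖) * w s
      linarith
    rw [norm_smul, norm_inv, Real.norm_of_nonneg (hwpos t).le, inv_mul_le_iff₀ (hwpos t)]
    have h7 : ‖x₀‖ * 1 ≤ ‖x₀‖ * w t := by gcongr; exact hw1 t
    have := norm_add_le x₀ (∫ s in (0 : ℝ)..t, V (w s • Y s))
    linarith
  let T : BoundedContinuousFunction ℝ X → BoundedContinuousFunction ℝ X := fun Y =>
    BoundedContinuousFunction.ofNormedAddCommGroup
      (fun t => (w t)⁻¹ • (x₀ + ∫ s in (0 : ℝ)..t, V (w s • Y s)))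
      ((hwc.inv₀ fun t => (hwpos t).ne').smul (continuous_const.add (hprim Y)))
      (‖x₀‖ + (‖V 0‖ + k * ‖Y‖) / (2 * k)) (hbd Y)
  have hT : ∀ Y t, T Y t = (w t)⁻¹ • (x₀ + ∫ s in (0 : ℝ)..t, V (w s • Y s)) := fun _ _ => rfl
  have hcontr : ContractingWith (1 / 2) T := by
    refine ⟨by rw [← NNReal.coe_lt_coe]; norm_num, LipschitzWith.of_dist_le_mul fun Y Z => ?_⟩
    rw [BoundedContinuousFunction.dist_le (by positivity)]
    intro t
    rw [dist_eq_norm, hT, hT, ← smul_sub, add_sub_add_left_eq_sub,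
      ← intervalIntegral.integral_sub ((hint Y).intervalIntegrable _ _)
        ((hint Z).intervalIntegrable _ _), norm_smul, norm_inv,
      Real.norm_of_nonneg (hwpos t).le, inv_mul_le_iff₀ (hwpos t)]
    have h1 := norm_integral_le_exp_abs (g := fun s => V (w s • Y s) - V (w s • Z s))
      (C := k * dist Y Z) (c := 2 * k) (by positivity) (by positivity) (fun s => by
        refine (hVk _ _).trans ?_
        rw [← smul_sub, norm_smul, Real.norm_of_nonneg (hwpos s).le, ← dist_eq_norm]
        have := BoundedContinuousFunction.dist_coe_le_dist (f := Y) (g := Z) s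
        calc k * (w s * dist (Y s) (Z s)) ≤ k * (w s * dist Y Z) := by
              have := (hwpos s).le
              gcongr
          _ = k * dist Y Z * exp (2 * k * |s|) := by simp only [hw]; ring) t
    refine h1.trans (le_of_eq ?_)
    simp only [hw]
    push_cast
    field_simp
  set Y := hcontr.fixedPoint T
  have hY : T Y = Y := hcontr.fixedPoint_isFixedPt
  have hγ : ∀ t, w t • Y t = x₀ + ∫ s in (0 : ℝ)..t, V (w s • Y s) := fun t => by
    conv_lhs => rw [← hY]
    rw [hT, smul_inv_smul₀ (hwpos t).ne']
  refine ⟨fun t => w t • Y t, ?_, fun t => ?_⟩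
  · simpa using hγ 0
  · have h1 : HasDerivAt (fun t => ∫ s in (0 : ℝ)..t, V (w s • Y s)) (V (w t • Y t)) t :=
      (hint Y).integral_hasStrictDerivAt 0 t |>.hasDerivAt
    exact (h1.const_add x₀).congr_of_eventuallyEq (Eventually.of_forall hγ)

theorem dist_integralCurve_le {V : X → X} {K : NNReal} (hV : LipschitzWith K V) {γ δ : ℝ → X}
    (hγ : ∀ t, HasDerivAt γ (V (γ t)) t) (hδ : ∀ t, HasDerivAt δ (V (δ t)) t) (t : ℝ) :
    dist (γ t) (δ t) ≤ dist (γ 0) (δ 0) * exp (K * |t|) := by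
  have key : ∀ {W : X → X}, LipschitzWith K W → ∀ {γ δ : ℝ → X},
      (∀ t, HasDerivAt γ (W (γ t)) t) → (∀ t, HasDerivAt δ (W (δ t)) t) → ∀ t, 0 ≤ t →
      dist (γ t) (δ t) ≤ dist (γ 0) (δ 0) * exp (K * |t|) := by
    intro W hW γ δ hγ hδ t ht
    have h := dist_le_of_trajectories_ODE (v := fun _ => W) (a := 0) (b := t) (fun _ => hW)
      (fun s _ => (hγ s).continuousAt.continuousWithinAt) (fun s _ => (hγ s).hasDerivWithinAt)
      (fun s _ => (hδ s).continuousAt.continuousWithinAt) (fun s _ => (hδ s).hasDerivWithinAt)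
      le_rfl t ⟨ht, le_rfl⟩
    simpa [abs_of_nonneg ht] using h
  rcases le_total 0 t with ht | ht
  · exact key hV hγ hδ t ht
  · have hneg : ∀ {γ : ℝ → X}, (∀ t, HasDerivAt γ (V (γ t)) t) →
        ∀ t, HasDerivAt (fun s => γ (-s)) (-V (γ (-t))) t := fun {γ} hγ t => by
      have h := (hγ (-t)).scomp t (hasDerivAt_neg t)
      rw [neg_one_smul] at h
      exact h
    have h := key (W := fun x => -V x) hV.neg (hneg hγ) (hneg hδ) (-t) (by linarith)
    simpa using h

end GlobalFlow

section RealLemmas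

theorem lt_of_hasDerivAt_pos {g g' : ℝ → ℝ} (hg : ∀ s, HasDerivAt g (g' s) s) {u v : ℝ}
    (huv : u < v) (h : ∀ s ∈ Set.Ioo u v, 0 < g' s) : g u < g v := by
  obtain ⟨c, hc, hs⟩ := exists_hasDerivAt_eq_slope g g' huv
    (fun s _ => (hg s).continuousAt.continuousWithinAt) fun s _ => hg s
  have := h c hc
  rw [hs] at this
  have h2 : 0 < v - u := sub_pos.2 huv
  have := (div_pos_iff_of_pos_right h2).1 this
  linarith

theorem le_sub_of_hasDerivAt_ge {g g' : ℝ → ℝ} (hg : ∀ s, HasDerivAt g (g' s) s) {u v ε : ℝ}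
    (huv : u ≤ v) (h : ∀ s ∈ Set.Ioo u v, ε ≤ g' s) : ε * (v - u) ≤ g v - g u := by
  rcases huv.eq_or_lt with rfl | huv
  · simp
  obtain ⟨c, hc, hs⟩ := exists_hasDerivAt_eq_slope g g' huv
    (fun s _ => (hg s).continuousAt.continuousWithinAt) fun s _ => hg s
  have := h c hc
  rw [hs] at this
  exact (le_div_iff₀ (sub_pos.2 huv)).1 this

theorem exists_pos_forall_Ioo_pos {g g' : ℝ → ℝ} (hg : ∀ s, HasDerivAt g (g' s) s)
    (hc : ContinuousAt g' 0) (h0 : g 0 = 0) (h1 : 0 < g' 0) :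
    ∃ δ > 0, ∀ s ∈ Set.Ioo 0 δ, 0 < g s := by
  obtain ⟨δ, hδ, h⟩ := Metric.eventually_nhds_iff.1 (hc.eventually (lt_mem_nhds h1))
  refine ⟨δ, hδ, fun s hs => ?_⟩
  rw [← h0]
  refine lt_of_hasDerivAt_pos hg hs.1 fun r hr => h ?_
  rw [Real.dist_eq, sub_zero, abs_of_pos hr.1]
  exact hr.2.trans hs.2

/-- The first time at which a continuous function that is initially positive stops being so. -/
theorem exists_first_nonpos {g : ℝ → ℝ} (hg : Continuous g) {δ : ℝ} (hδ : 0 < δ)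
    (h : ∀ s ∈ Set.Ioo 0 δ, 0 < g s) {t : ℝ} (ht : 0 < t) (hgt : g t ≤ 0) :
    ∃ ξ > 0, g ξ ≤ 0 ∧ ∀ s ∈ Set.Ioo 0 ξ, 0 < g s := by
  set S : Set ℝ := Set.Ici δ ∩ g ⁻¹' Set.Iic 0 with hS
  have hSc : IsClosed S := isClosed_Ici.inter (isClosed_Iic.preimage hg)
  have hbdd : BddBelow S := ⟨δ, fun s hs => hs.1⟩
  have hne : S.Nonempty := by
    refine ⟨t, ?_, hgt⟩
    by_contra hlt
    exact absurd (h t ⟨ht, not_le.1 hlt⟩) (not_lt.2 hgt)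
  have hmem := hSc.csInf_mem hne hbdd
  refine ⟨sInf S, hδ.trans_le hmem.1, hmem.2, fun s hs => ?_⟩
  by_contra hcon
  rcases lt_or_ge s δ with hsδ | hsδ
  · exact hcon (h s ⟨hs.1, hsδ⟩)
  · exact absurd (csInf_le hbdd ⟨hsδ, not_lt.1 hcon⟩) (not_le.2 hs.2)

/-- Positivity on `(0, t]` of functions vanishing at `0` with positive derivative there is an open
condition on the parameter. -/
theorem eventually_forall_Ioc_pos {φ ψ : ℝ → ℝ → ℝ} (hφ : Continuous fun q : ℝ × ℝ => φ q.1 q.2)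
    (hψ : Continuous fun q : ℝ × ℝ => ψ q.1 q.2) (hd : ∀ b s, HasDerivAt (φ b) (ψ b s) s)
    (h0 : ∀ b, φ b 0 = 0) {b t : ℝ} (hb : 0 < ψ b 0) (hpos : ∀ s ∈ Set.Ioc 0 t, 0 < φ b s) :
    ∀ᶠ c in nhds b, ∀ s ∈ Set.Ioc 0 t, 0 < φ c s := by
  obtain ⟨ε, hε, h⟩ := Metric.eventually_nhds_iff.1
    ((hψ.continuousAt (x := (b, 0))).eventually (lt_mem_nhds hb))
  have h1 : ∀ᶠ c in nhds b, ∀ s ∈ Set.Icc (ε / 2) t, 0 < φ c s := by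
    refine isCompact_Icc.eventually_forall_of_forall_eventually fun s hs => ?_
    exact hφ.continuousAt.eventually
      (lt_mem_nhds (hpos s ⟨by linarith [hs.1], hs.2⟩))
  filter_upwards [h1, Metric.ball_mem_nhds b hε] with c hc hcb s hs
  rcases le_or_gt (ε / 2) s with hsε | hsε
  · exact hc s ⟨hsε, hs.2⟩
  · rw [← h0 c]
    refine lt_of_hasDerivAt_pos (hd c) hs.1 fun r hr => h (y := (c, r)) ?_
    rw [Prod.dist_eq, max_lt_iff]
    refine ⟨hcb, ?_⟩
    simp only [Real.dist_eq, sub_zero, abs_of_pos hr.1]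
    linarith [hr.2]

end RealLemmas

section FourthOrder

/-- A solution of `x'''' - A x'' - f(x) = 0`, written as a first-order system in the unknowns
`x`, `y = x'`, `z = x''`, `h = x''' - A x'`. -/
structure IsSolution (A : ℝ) (f : ℝ → ℝ) (x y z h : ℝ → ℝ) : Prop where
  hx : ∀ t, HasDerivAt x (y t) t
  hy : ∀ t, HasDerivAt y (z t) t
  hz : ∀ t, HasDerivAt z (A * y t + h t) t
  hh : ∀ t, HasDerivAt h (f (x t)) t

variable {A : ℝ} {f : ℝ → ℝ}

/-- The vector field of the first-order system. -/
def vectorField (A : ℝ) (f : ℝ → ℝ) (q : ℝ × ℝ × ℝ × ℝ) : ℝ × ℝ × ℝ × ℝ :=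
  (q.2.1, q.2.2.1, A * q.2.1 + q.2.2.2, f q.1)

theorem exists_lipschitzWith_vectorField (A : ℝ) {K : NNReal} (hf : LipschitzWith K f) :
    ∃ K' : NNReal, LipschitzWith K' (vectorField A f) := by
  have h1 : LipschitzWith 1 (fun q : ℝ × ℝ × ℝ × ℝ => q.1) := LipschitzWith.prod_fst
  have h2 : LipschitzWith (1 * 1) (fun q : ℝ × ℝ × ℝ × ℝ => q.2.1) :=
    LipschitzWith.prod_fst.comp LipschitzWith.prod_snd
  have h22 : LipschitzWith (1 * 1) (fun q : ℝ × ℝ × ℝ × ℝ => q.2.2) :=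
    LipschitzWith.prod_snd.comp LipschitzWith.prod_snd
  have h3 := (LipschitzWith.prod_fst (α := ℝ) (β := ℝ)).comp h22
  have h4 := (LipschitzWith.prod_snd (α := ℝ) (β := ℝ)).comp h22
  exact ⟨_, h2.prodMk (h3.prodMk ((((lipschitzWith_smul A).comp h2).add h4).prodMk (hf.comp h1)))⟩

theorem IsSolution.hasDerivAt {x y z h : ℝ → ℝ} (hs : IsSolution A f x y z h) (t : ℝ) :
    HasDerivAt (fun t => (x t, y t, z t, h t)) (vectorField A f (x t, y t, z t, h t)) t :=
  (hs.hx t).prodMk ((hs.hy t).prodMk ((hs.hz t).prodMk (hs.hh t)))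

theorem exists_isSolution {K : NNReal} (hf : LipschitzWith K f) (A x₀ y₀ z₀ h₀ : ℝ) :
    ∃ x y z h : ℝ → ℝ, IsSolution A f x y z h ∧ x 0 = x₀ ∧ y 0 = y₀ ∧ z 0 = z₀ ∧ h 0 = h₀ := by
  obtain ⟨K', hK'⟩ := exists_lipschitzWith_vectorField A hf
  obtain ⟨γ, h0, hγ⟩ := exists_global_integralCurve hK' (x₀, y₀, z₀, h₀)
  refine ⟨fun t => (γ t).1, fun t => (γ t).2.1, fun t => (γ t).2.2.1, fun t => (γ t).2.2.2,
    ⟨fun t => (hγ t).fst, fun t => (hγ t).snd.fst, fun t => (hγ t).snd.snd.fst,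
      fun t => (hγ t).snd.snd.snd⟩, ?_⟩
  simp [h0]

theorem IsSolution.unique {K : NNReal} (hf : LipschitzWith K f) {x y z h x' y' z' h' : ℝ → ℝ}
    (hs : IsSolution A f x y z h) (hs' : IsSolution A f x' y' z' h') (hx0 : x 0 = x' 0)
    (hy0 : y 0 = y' 0) (hz0 : z 0 = z' 0) (hh0 : h 0 = h' 0) (t : ℝ) : x t = x' t := by
  obtain ⟨K', hK'⟩ := exists_lipschitzWith_vectorField A hf
  have := dist_integralCurve_le hK' hs.hasDerivAt hs'.hasDerivAt t
  simp only [hx0, hy0, hz0, hh0, dist_self, zero_mul] at this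
  exact congrArg Prod.fst (dist_le_zero.1 this)

/-- The system is reversible: solutions are symmetric about any point where `x'` and `x'''`
vanish. -/
theorem IsSolution.reflect {K : NNReal} (hf : LipschitzWith K f) {x y z h : ℝ → ℝ}
    (hs : IsSolution A f x y z h) {ξ : ℝ} (hy0 : y ξ = 0) (hh0 : h ξ = 0) (t : ℝ) :
    x (ξ + t) = x (ξ - t) := by
  have h1 : IsSolution A f (fun t => x (ξ + t)) (fun t => y (ξ + t)) (fun t => z (ξ + t))
      (fun t => h (ξ + t)) :=
    ⟨fun t => (hs.hx _).comp_const_add _ _, fun t => (hs.hy _).comp_const_add _ _,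
      fun t => (hs.hz _).comp_const_add _ _, fun t => (hs.hh _).comp_const_add _ _⟩
  have h2 : IsSolution A f (fun t => x (ξ - t)) (fun t => -y (ξ - t)) (fun t => z (ξ - t))
      (fun t => -h (ξ - t)) := by
    refine ⟨fun t => (hs.hx _).comp_const_sub _ _, fun t => ?_, fun t => ?_, fun t => ?_⟩
    · simpa using ((hs.hy (ξ - t)).comp_const_sub ξ t).fun_neg
    · refine ((hs.hz (ξ - t)).comp_const_sub ξ t).congr_deriv (by ring)
    · simpa using ((hs.hh (ξ - t)).comp_const_sub ξ t).fun_neg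
  exact h1.unique hf h2 (by simp) (by simp [hy0]) (by simp) (by simp [hh0]) t

/-- The one-parameter family of solutions issued from `(a, 0, β, 0)` depends continuously on
`(β, t)`. -/
theorem exists_continuous_family {K : NNReal} (hf : LipschitzWith K f) (A a : ℝ) :
    ∃ x y z h : ℝ → ℝ → ℝ, (∀ b, IsSolution A f (x b) (y b) (z b) (h b)) ∧
      (∀ b, x b 0 = a ∧ y b 0 = 0 ∧ z b 0 = b ∧ h b 0 = 0) ∧
      Continuous (fun q : ℝ × ℝ => x q.1 q.2) ∧ Continuous (fun q : ℝ × ℝ => y q.1 q.2) ∧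
      Continuous (fun q : ℝ × ℝ => z q.1 q.2) ∧ Continuous (fun q : ℝ × ℝ => h q.1 q.2) := by
  choose x y z h hs h0 using fun b => exists_isSolution hf A a 0 b 0
  obtain ⟨K', hK'⟩ := exists_lipschitzWith_vectorField A hf
  have hc : Continuous fun q : ℝ × ℝ => (x q.1 q.2, y q.1 q.2, z q.1 q.2, h q.1 q.2) := by
    rw [continuous_iff_continuousAt]
    rintro ⟨b, t⟩
    have hlim : Tendsto (fun q : ℝ × ℝ => dist q.1 b * exp (K' * |q.2|) +
        dist (x b q.2, y b q.2, z b q.2, h b q.2) (x b t, y b t, z b t, h b t))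
        (nhds (b, t)) (nhds (dist b b * exp (K' * |t|) +
        dist (x b t, y b t, z b t, h b t) (x b t, y b t, z b t, h b t))) := by
      have h1 : ContinuousAt (fun q : ℝ × ℝ => dist q.1 b * exp (K' * |q.2|)) (b, t) := by
        fun_prop
      have h2 : ContinuousAt (fun q : ℝ × ℝ => (x b q.2, y b q.2, z b q.2, h b q.2)) (b, t) :=
        ContinuousAt.comp (f := fun q : ℝ × ℝ => q.2)
          (g := fun s => (x b s, y b s, z b s, h b s)) ((hs b).hasDerivAt t).continuousAt
          continuousAt_snd
      exact h1.tendsto.add (h2.tendsto.dist tendsto_const_nhds)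
    rw [dist_self, dist_self, zero_mul, zero_add] at hlim
    refine tendsto_iff_dist_tendsto_zero.2
      (squeeze_zero (fun _ => dist_nonneg) (fun q => ?_) hlim)
    refine (dist_triangle _ (x b q.2, y b q.2, z b q.2, h b q.2) _).trans ?_
    gcongr
    refine (dist_integralCurve_le hK' (hs q.1).hasDerivAt (hs b).hasDerivAt q.2).trans ?_
    obtain ⟨e1, e2, e3, e4⟩ := h0 q.1
    obtain ⟨e1', e2', e3', e4'⟩ := h0 b
    simp only [e1, e2, e3, e4, e1', e2', e3', e4', Prod.dist_eq, dist_self]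
    simp
  exact ⟨x, y, z, h, hs, h0, hc.fst, hc.snd.fst, hc.snd.snd.fst, hc.snd.snd.snd⟩

end FourthOrder

section Shooting

variable {A a a₀ : ℝ} {f x y z h : ℝ → ℝ}

theorem IsSolution.strictMonoOn (hs : IsSolution A f x y z h) {ξ : ℝ}
    (hy : ∀ s ∈ Set.Ioo 0 ξ, 0 < y s) : StrictMonoOn x (Set.Icc 0 ξ) := fun _ hu _ hv huv =>
  lt_of_hasDerivAt_pos hs.hx huv fun s hsuv =>
    hy s ⟨hu.1.trans_lt hsuv.1, hsuv.2.trans_le hv.2⟩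

/-- `h` is negative as long as `x` increases and stays below the equilibrium `a₀`. -/
theorem IsSolution.h_neg (hs : IsSolution A f x y z h) (hneg : ∀ v ∈ Set.Ico a a₀, f v < 0)
    (hx0 : x 0 = a) (hh0 : h 0 = 0) {t : ℝ} (ht : 0 < t) (hy : ∀ s ∈ Set.Ioo 0 t, 0 < y s)
    (hxt : x t ≤ a₀) : h t < 0 := by
  have hmono := hs.strictMonoOn hy
  have := lt_of_hasDerivAt_pos (g := fun s => -h s) (g' := fun s => -f (x s))
    (fun s => (hs.hh s).neg) ht fun s hs' => by
      have h1 := hmono (Set.left_mem_Icc.2 ht.le) ⟨hs'.1.le, hs'.2.le⟩ hs'.1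
      have h2 := hmono ⟨hs'.1.le, hs'.2.le⟩ (Set.right_mem_Icc.2 ht.le) hs'.2
      have := hneg (x s) ⟨by linarith, by linarith⟩
      linarith
  simp only [hh0] at this
  linarith

/-- If `x` increases for all positive times, then `h` becomes positive. -/
theorem IsSolution.exists_h_pos (hs : IsSolution A f x y z h)
    (hneg : ∀ v ∈ Set.Ico a a₀, f v < 0)
    (hpos : ∀ l > a₀, ∃ ε > 0, ∀ v ≥ l, ε ≤ f v) (hA : 0 < A)
    (hx0 : x 0 = a) (hh0 : h 0 = 0) (hy : ∀ t > 0, 0 < y t) : ∃ t > 0, 0 < h t := by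
  have hmono : ∀ {u v : ℝ}, 0 ≤ u → u ≤ v → x u ≤ x v := fun {_ v} hu huv =>
    (hs.strictMonoOn (ξ := v) fun s h => hy s h.1).monotoneOn ⟨hu, huv⟩
      ⟨hu.trans huv, le_rfl⟩ huv
  by_cases hbig : ∃ t ≥ 0, a₀ < x t
  · obtain ⟨t₁, ht₁, hx₁⟩ := hbig
    obtain ⟨ε, hε, hfε⟩ := hpos _ hx₁
    set T := t₁ + (|h t₁| + 1) / ε with hT
    have hTt : t₁ < T := by rw [hT]; have : 0 < (|h t₁| + 1) / ε := by positivity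
                            linarith
    have := le_sub_of_hasDerivAt_ge hs.hh hTt.le fun s h => hfε _ (hmono ht₁ h.1.le)
    have h2 : ε * (T - t₁) = |h t₁| + 1 := by rw [hT]; field_simp; ring
    refine ⟨T, by linarith, ?_⟩
    linarith [neg_abs_le (h t₁)]
  · push Not at hbig
    exfalso
    have hhneg : ∀ t > 0, h t < 0 := fun t ht =>
      hs.h_neg hneg hx0 hh0 ht (fun s h => hy s h.1) (hbig t ht.le)
    have hanti : ∀ t ≥ 1, h t ≤ h 1 := fun t ht => by
      have := le_sub_of_hasDerivAt_ge (g := fun s => -h s) (g' := fun s => -f (x s)) (ε := 0)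
        (fun s => (hs.hh s).neg) ht fun s hs' => by
          have h0s : 0 < s := by linarith [hs'.1]
          have h1 : x 0 < x s := lt_of_hasDerivAt_pos hs.hx h0s fun r hr => hy r hr.1
          have h2 : x s < x (s + 1) :=
            lt_of_hasDerivAt_pos hs.hx (by linarith) fun r hr => hy r (h0s.trans hr.1)
          have := hneg (x s) ⟨by linarith, h2.trans_le (hbig _ (by linarith))⟩
          linarith
      linarith
    have h1 := hhneg 1 one_pos
    set c := -h 1 with hc
    have hcpos : 0 < c := by linarith
    have hz : ∀ t ≥ 1, z t ≤ z 1 - A * x 1 + A * a₀ - c * (t - 1) := fun t ht => by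
      have := le_sub_of_hasDerivAt_ge (g := fun s => A * x s - z s) (ε := c)
        (fun s => ((hs.hx s).const_mul A).sub (hs.hz s)) ht fun s hs' => by
          have := hanti s hs'.1.le
          linarith
      have := mul_le_mul_of_nonneg_left (hbig t (by linarith)) hA.le
      linarith
    set D := z 1 - A * x 1 + A * a₀ with hD
    set T := 1 + (|D| + 1) / c with hT
    have hT1 : 1 < T := by rw [hT]; have : 0 < (|D| + 1) / c := by positivity
                           linarith
    have hcT : c * (T - 1) = |D| + 1 := by rw [hT]; field_simp; ring
    have hz2 : ∀ t ≥ T, z t ≤ -1 := fun t ht => by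
      have h3 := hz t (by linarith)
      have h4 : c * (T - 1) ≤ c * (t - 1) := by gcongr
      linarith [le_abs_self D]
    have hyT := hy T (by linarith)
    have := le_sub_of_hasDerivAt_ge (g := fun s => -y s) (g' := fun s => -z s) (ε := 1)
      (u := T) (v := T + y T) (fun s => (hs.hy s).neg) (by linarith) fun s hs' => by
        linarith [hz2 s hs'.1.le]
    have h5 := hy (T + y T) (by linarith)
    linarith

/-- The three possible behaviours of an increasing shot: `x'` becomes negative before `h` becomes
nonnegative, `h` becomes positive while `x'` is still positive, or both vanish simultaneously. -/
theorem IsSolution.trichotomy (hs : IsSolution A f x y z h)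
    (hneg : ∀ v ∈ Set.Ico a a₀, f v < 0) (hpos : ∀ l > a₀, ∃ ε > 0, ∀ v ≥ l, ε ≤ f v)
    (hA : 0 < A) (hx0 : x 0 = a) (hy0 : y 0 = 0) (hz0 : 0 < z 0) (hh0 : h 0 = 0) :
    (∃ t > 0, y t < 0 ∧ ∀ s ∈ Set.Ioc 0 t, h s < 0) ∨
    (∃ t > 0, 0 < h t ∧ ∀ s ∈ Set.Ioc 0 t, 0 < y s) ∨
    ∃ ξ > 0, y ξ = 0 ∧ h ξ = 0 ∧ ∀ s ∈ Set.Ioo 0 ξ, 0 < y s := by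
  have hyc : Continuous y := continuous_iff_continuousAt.2 fun t => (hs.hy t).continuousAt
  have hhc : Continuous h := continuous_iff_continuousAt.2 fun t => (hs.hh t).continuousAt
  have hzc : Continuous z := continuous_iff_continuousAt.2 fun t => (hs.hz t).continuousAt
  by_cases hall : ∀ t > 0, 0 < y t
  · obtain ⟨t, ht, hht⟩ := hs.exists_h_pos hneg hpos hA hx0 hh0 hall
    exact Or.inr (Or.inl ⟨t, ht, hht, fun s h => hall s h.1⟩)
  push Not at hall
  obtain ⟨t₁, ht₁, hyt₁⟩ := hall
  obtain ⟨δ, hδ, hyδ⟩ := exists_pos_forall_Ioo_pos hs.hy hzc.continuousAt hy0 hz0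
  obtain ⟨ξ, hξ, hyξ, hlt⟩ := exists_first_nonpos hyc hδ hyδ ht₁ hyt₁
  have hnear : ∀ᶠ t in nhdsWithin ξ (Set.Iio ξ), t ∈ Set.Ioo 0 ξ := Ioo_mem_nhdsLT hξ
  have hyξ0 : y ξ = 0 := by
    refine le_antisymm hyξ ?_
    refine ge_of_tendsto
      ((hyc.tendsto ξ).mono_left (nhdsWithin_le_nhds : nhdsWithin ξ (Set.Iio ξ) ≤ nhds ξ)) ?_
    filter_upwards [hnear] with t ht using (hlt t ht).le
  rcases lt_trichotomy (h ξ) 0 with hh | hh | hh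
  · left
    have hzξ : z ξ < 0 := by
      by_contra! hcon
      have hk : Continuous fun s => A * y s + h s := by fun_prop
      have hkξ : A * y ξ + h ξ < 0 := by rw [hyξ0]; linarith
      obtain ⟨η, hη, hηk⟩ := Metric.eventually_nhds_iff.1
        (hk.continuousAt.eventually (gt_mem_nhds hkξ))
      set u := max (ξ - η / 2) (ξ / 2) with hu
      have hu1 : ξ - η / 2 ≤ u := le_max_left _ _
      have hu2 : ξ / 2 ≤ u := le_max_right _ _
      have hu3 : u < ξ := max_lt (by linarith) (by linarith)
      have hzpos : ∀ s ∈ Set.Ioo u ξ, 0 < z s := fun s hsu => by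
        have := lt_of_hasDerivAt_pos (g := fun s => -z s) (fun s => (hs.hz s).neg) hsu.2
          fun r hr => by
            have := hηk (y := r) (by
              rw [Real.dist_eq, abs_lt]
              constructor <;> linarith [hr.1, hr.2, hsu.1])
            linarith
        linarith
      have h1 := lt_of_hasDerivAt_pos hs.hy hu3 hzpos
      have h2 := hlt u ⟨by linarith, hu3⟩
      linarith
    have hhneg : ∀ s ∈ Set.Ioc 0 ξ, h s < 0 := fun s hsξ => by
      have hmono := hs.strictMonoOn hlt
      rcases le_or_gt (x s) a₀ with hxs | hxs
      · exact hs.h_neg hneg hx0 hh0 hsξ.1 (fun r hr => hlt r ⟨hr.1, hr.2.trans_le hsξ.2⟩) hxs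
      · refine lt_of_le_of_lt ?_ hh
        have := le_sub_of_hasDerivAt_ge hs.hh (ε := 0) hsξ.2 fun r hr => by
          obtain ⟨ε, hε, hfε⟩ := hpos _ hxs
          refine hε.le.trans (hfε _ ?_)
          exact (hmono ⟨hsξ.1.le, hsξ.2⟩ ⟨by linarith [hsξ.1, hr.1], hr.2.le⟩ hr.1).le
        linarith
    obtain ⟨η₁, hη₁, hη₁h⟩ := Metric.eventually_nhds_iff.1
      (hhc.continuousAt.eventually (gt_mem_nhds hh))
    obtain ⟨η₂, hη₂, hη₂z⟩ := Metric.eventually_nhds_iff.1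
      (hzc.continuousAt.eventually (gt_mem_nhds hzξ))
    have hm : 0 < min η₁ η₂ := lt_min hη₁ hη₂
    refine ⟨ξ + min η₁ η₂ / 2, by linarith, ?_, fun s hs' => ?_⟩
    · have := lt_of_hasDerivAt_pos (g := fun s => -y s) (g' := fun s => -z s)
        (u := ξ) (v := ξ + min η₁ η₂ / 2) (fun s => (hs.hy s).neg) (by linarith) fun s hs' => by
          have := hη₂z (y := s) (by
            rw [Real.dist_eq, abs_of_pos (by linarith [hs'.1])]
            linarith [hs'.2, min_le_right η₁ η₂])
          linarith
      linarith
    · rcases le_or_gt s ξ with hsξ | hsξ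
      · exact hhneg s ⟨hs'.1, hsξ⟩
      · refine hη₁h ?_
        rw [Real.dist_eq, abs_of_pos (by linarith)]
        linarith [hs'.2, min_le_left η₁ η₂]
  · exact Or.inr (Or.inr ⟨ξ, hξ, hyξ0, hh, hlt⟩)
  · right; left
    have h1 : ∀ᶠ t in nhdsWithin ξ (Set.Iio ξ), 0 < h t :=
      (hhc.continuousAt.eventually (lt_mem_nhds hh)).filter_mono nhdsWithin_le_nhds
    obtain ⟨t, hht, ht⟩ := (h1.and hnear).exists
    exact ⟨t, ht.1, hht, fun s hst => hlt s ⟨hst.1, hst.2.trans_lt ht.2⟩⟩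

/-- With `A = l + m` and initial second derivative `m * a`, the solution increases forever. -/
theorem IsSolution.forall_y_pos {l m : ℝ} (hs : IsSolution (l + m) f x y z h) (hf : Continuous f)
    (hl : 0 < l) (hm : 0 < m) (ha : 0 < a) (hg : ∀ v ≥ a, 0 < f v + l * m * v)
    (hx0 : x 0 = a) (hy0 : y 0 = 0) (hz0 : z 0 = m * a) (hh0 : h 0 = 0) :
    ∀ t > 0, 0 < y t := by
  have hxc : Continuous x := continuous_iff_continuousAt.2 fun t => (hs.hx t).continuousAt
  have hyc : Continuous y := continuous_iff_continuousAt.2 fun t => (hs.hy t).continuousAt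
  have hhc : Continuous h := continuous_iff_continuousAt.2 fun t => (hs.hh t).continuousAt
  have hzc : Continuous z := continuous_iff_continuousAt.2 fun t => (hs.hz t).continuousAt
  have hw : ∀ t, HasDerivAt (fun t => z t - m * x t) (l * y t + h t) t := fun t =>
    ((hs.hz t).sub ((hs.hx t).const_mul m)).congr_deriv (by ring)
  have hq : ∀ t, HasDerivAt (fun t => l * y t + h t) (l * z t + f (x t)) t := fun t =>
    ((hs.hy t).const_mul l).add (hs.hh t)
  have hq0 : 0 < l * z 0 + f (x 0) := by
    have := hg a le_rfl
    rw [hz0, hx0]; linarith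
  obtain ⟨δ₁, hδ₁, h1⟩ := exists_pos_forall_Ioo_pos hs.hy hzc.continuousAt hy0
    (by rw [hz0]; positivity)
  obtain ⟨δ₂, hδ₂, h2⟩ := exists_pos_forall_Ioo_pos hq (by fun_prop) (by simp [hy0, hh0]) hq0
  by_contra! hcon
  obtain ⟨t, ht, hyt⟩ := hcon
  have hmin : Continuous fun t => min (y t) (l * y t + h t) := by fun_prop
  obtain ⟨ξ, hξ, hle, hlt⟩ := exists_first_nonpos hmin (lt_min hδ₁ hδ₂)
    (fun s hs' => lt_min (h1 s ⟨hs'.1, hs'.2.trans_le (min_le_left _ _)⟩)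
      (h2 s ⟨hs'.1, hs'.2.trans_le (min_le_right _ _)⟩)) ht ((min_le_left _ _).trans hyt)
  have hxa : ∀ s ∈ Set.Ioo 0 ξ, a < x s := fun s hs' => by
    rw [← hx0]
    exact lt_of_hasDerivAt_pos hs.hx hs'.1 fun r hr =>
      (lt_min_iff.1 (hlt r ⟨hr.1, hr.2.trans hs'.2⟩)).1
  have hwpos : ∀ s ∈ Set.Ioo 0 ξ, 0 < z s - m * x s := fun s hs' => by
    have := lt_of_hasDerivAt_pos hw hs'.1 fun r hr =>
      (lt_min_iff.1 (hlt r ⟨hr.1, hr.2.trans hs'.2⟩)).2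
    simp only [hz0, hx0] at this
    linarith
  have hyξ : 0 < y ξ := by
    rw [← hy0]
    refine lt_of_hasDerivAt_pos hs.hy hξ fun r hr => ?_
    have h3 := hwpos r hr
    have h4 : 0 < m * x r := mul_pos hm (ha.trans (hxa r hr))
    linarith
  have hqξ : 0 < l * y ξ + h ξ := by
    have := lt_of_hasDerivAt_pos hq hξ fun r hr => by
      have h3 := mul_pos hl (hwpos r hr)
      have h4 := hg _ (hxa r hr).le
      linarith
    simpa [hy0, hh0] using this
  exact absurd (lt_min hyξ hqξ) (not_lt.2 hle)

/-- With vanishing initial second derivative, the solution decreases at first. -/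
theorem IsSolution.exists_y_neg (hs : IsSolution A f x y z h) (hf : Continuous f)
    (hfa : f a < 0) (hx0 : x 0 = a) (hy0 : y 0 = 0) (hz0 : z 0 = 0) (hh0 : h 0 = 0) :
    ∃ t > 0, y t < 0 ∧ ∀ s ∈ Set.Ioc 0 t, h s < 0 := by
  have hxc : Continuous x := continuous_iff_continuousAt.2 fun t => (hs.hx t).continuousAt
  have hzc : Continuous z := continuous_iff_continuousAt.2 fun t => (hs.hz t).continuousAt
  obtain ⟨δ₁, hδ₁, h1⟩ := exists_pos_forall_Ioo_pos (g := fun s => -h s)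
    (g' := fun s => -f (x s)) (fun s => (hs.hh s).neg) (by fun_prop) (by simp [hh0])
    (by rw [hx0]; linarith)
  obtain ⟨δ₂, hδ₂, h2⟩ := exists_pos_forall_Ioo_pos (g := fun s => -(A * y s + h s))
    (g' := fun s => -(A * z s + f (x s)))
    (fun s => (((hs.hy s).const_mul A).add (hs.hh s)).neg) (by fun_prop) (by simp [hy0, hh0])
    (by rw [hx0, hz0]; linarith)
  have hm : 0 < min δ₁ δ₂ := lt_min hδ₁ hδ₂
  have h3 : ∀ s ∈ Set.Ioo 0 δ₂, z s < 0 := fun s hs' => by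
    have := lt_of_hasDerivAt_pos (g := fun s => -z s) (fun s => (hs.hz s).neg) hs'.1
      fun r hr => h2 r ⟨hr.1, hr.2.trans hs'.2⟩
    simp only [hz0] at this
    linarith
  refine ⟨min δ₁ δ₂ / 2, by linarith, ?_, fun s hs' => ?_⟩
  · have := lt_of_hasDerivAt_pos (g := fun s => -y s) (g' := fun s => -z s)
      (fun s => (hs.hy s).neg) (half_pos hm) fun r hr => by
        linarith [h3 r ⟨hr.1, by linarith [hr.2, min_le_right δ₁ δ₂]⟩]
    simp only [hy0] at this
    linarith
  · have := h1 s ⟨hs'.1, by linarith [hs'.2, min_le_left δ₁ δ₂]⟩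
    linarith

/-- The shooting argument: some solution issued from `(a, 0, β, 0)` satisfies
`x' = x''' = 0` at the end of an interval on which `x` increases. -/
theorem exists_shooting {l m : ℝ} {K : NNReal} (hf : LipschitzWith K f) (hl : 0 < l) (hm : 0 < m)
    (ha : a ∈ Set.Ioo 0 a₀) (hneg : ∀ v ∈ Set.Ico a a₀, f v < 0)
    (hpos : ∀ l > a₀, ∃ ε > 0, ∀ v ≥ l, ε ≤ f v) (hg : ∀ v ≥ a, 0 < f v + l * m * v) :
    ∃ (x y z h : ℝ → ℝ) (ξ : ℝ), IsSolution (l + m) f x y z h ∧ x 0 = a ∧ y 0 = 0 ∧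
      0 < z 0 ∧ z 0 ≤ m * a ∧ h 0 = 0 ∧ 0 < ξ ∧ y ξ = 0 ∧ h ξ = 0 ∧
      ∀ s ∈ Set.Ioo 0 ξ, 0 < y s := by
  obtain ⟨x, y, z, h, hs, h0, hxc, hyc, hzc, hhc⟩ := exists_continuous_family hf (l + m) a
  have hfc : Continuous f := hf.continuous
  have hfa : f a < 0 := hneg a ⟨le_rfl, ha.2⟩
  set U₁ : Set ℝ := {b | ∃ t > 0, y b t < 0 ∧ ∀ s ∈ Set.Ioc 0 t, h b s < 0} with hU₁
  set U₂ : Set ℝ := {b | 0 < b ∧ ∃ t > 0, 0 < h b t ∧ ∀ s ∈ Set.Ioc 0 t, 0 < y b s} with hU₂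
  have hopen₁ : IsOpen U₁ := by
    rw [isOpen_iff_mem_nhds]
    rintro b ⟨t, ht, hyt, hht⟩
    have h1 := eventually_forall_Ioc_pos (φ := fun b s => -h b s) (ψ := fun b s => -f (x b s))
      (b := b) (t := t) hhc.neg (hfc.comp hxc).neg (fun b s => ((hs b).hh s).neg)
      (fun b => by simp [(h0 b).2.2.2]) (by simp only [(h0 b).1]; linarith)
      (fun s hs' => by linarith [hht s hs'])
    have h2 : ∀ᶠ c in nhds b, y c t < 0 :=
      (hyc.comp (Continuous.prodMk_left t)).continuousAt.eventually (gt_mem_nhds hyt)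
    filter_upwards [h1, h2] with c hc1 hc2
    exact ⟨t, ht, hc2, fun s hs' => by linarith [hc1 s hs']⟩
  have hopen₂ : IsOpen U₂ := by
    rw [isOpen_iff_mem_nhds]
    rintro b ⟨hb, t, ht, hht, hyt⟩
    have h1 := eventually_forall_Ioc_pos hyc hzc (fun b s => (hs b).hy s)
      (fun b => (h0 b).2.1) (b := b) (by rw [(h0 b).2.2.1]; exact hb) hyt
    have h2 : ∀ᶠ c in nhds b, 0 < h c t :=
      (hhc.comp (Continuous.prodMk_left t)).continuousAt.eventually (lt_mem_nhds hht)
    filter_upwards [h1, h2, lt_mem_nhds hb] with c hc1 hc2 hc3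
    exact ⟨hc3, t, ht, hc2, hc1⟩
  have hma : 0 < m * a := mul_pos hm ha.1
  have hmem₁ : (0 : ℝ) ∈ U₁ :=
    (hs 0).exists_y_neg hfc hfa (h0 0).1 (h0 0).2.1 (h0 0).2.2.1 (h0 0).2.2.2
  have hmem₂ : m * a ∈ U₂ := by
    have hy := (hs (m * a)).forall_y_pos hfc hl hm ha.1 hg (h0 _).1 (h0 _).2.1 (h0 _).2.2.1
      (h0 _).2.2.2
    obtain ⟨t, ht, hht⟩ := (hs (m * a)).exists_h_pos hneg hpos (by positivity) (h0 _).1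
      (h0 _).2.2.2 hy
    exact ⟨hma, t, ht, hht, fun s hs' => hy s hs'.1⟩
  obtain ⟨b₀, hb₀, hb₀'⟩ : ∃ b ∈ U₁, b ∈ Set.Ioo 0 (m * a) := by
    have h1 : ∀ᶠ b in nhdsWithin 0 (Set.Ioi 0), b ∈ U₁ :=
      nhdsWithin_le_nhds (hopen₁.mem_nhds hmem₁)
    exact (h1.and (Ioo_mem_nhdsGT hma)).exists
  have hdisj : ∀ b ∈ U₁, b ∉ U₂ := by
    rintro b ⟨t, ht, hyt, hht⟩ ⟨-, s, hs', hhs, hys⟩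
    rcases le_total t s with hts | hst
    · exact absurd (hys t ⟨ht, hts⟩) hyt.not_gt
    · exact absurd (hht s ⟨hs', hst⟩) hhs.not_gt
  obtain ⟨b, hb, hnot⟩ : ∃ b ∈ Set.Icc b₀ (m * a), b ∉ U₁ ∪ U₂ := by
    by_contra! hcon
    obtain ⟨b, -, hb1, hb2⟩ := isPreconnected_Icc U₁ U₂ hopen₁ hopen₂ hcon
      ⟨b₀, ⟨le_rfl, hb₀'.2.le⟩, hb₀⟩ ⟨m * a, ⟨hb₀'.2.le, le_rfl⟩, hmem₂⟩
    exact hdisj b hb1 hb2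
  have hbpos : 0 < b := hb₀'.1.trans_le hb.1
  obtain ⟨e1, e2, e3, e4⟩ := h0 b
  rcases (hs b).trichotomy hneg hpos (by positivity) e1 e2 (by rwa [e3]) e4 with h1 | h1 | h1
  · exact absurd (Or.inl h1) hnot
  · exact absurd (Or.inr ⟨hbpos, h1⟩) hnot
  · obtain ⟨ξ, hξ, hyξ, hhξ, hlt⟩ := h1
    exact ⟨x b, y b, z b, h b, ξ, hs b, e1, e2, by rwa [e3], by rw [e3]; exact hb.2, e4, hξ, hyξ,
      hhξ, hlt⟩

end Shooting

section Symmetric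

variable {x y : ℝ → ℝ} {ξ : ℝ}

/-- A function symmetric about `0` and about `ξ > 0` and increasing in between is periodic with
minimal period `2 * ξ`, has one maximum and one minimum per period, and is symmetric about each of
its critical points. -/
theorem periodic_of_symmetric (hx : ∀ t, HasDerivAt x (y t) t) (hξ : 0 < ξ)
    (hev : ∀ t, x t = x (-t)) (hsym : ∀ t, x (ξ + t) = x (ξ - t))
    (hy : ∀ s ∈ Set.Ioo 0 ξ, 0 < y s) :
    (∀ t, x 0 ≤ x t ∧ x t ≤ x ξ) ∧ Function.Periodic x (2 * ξ) ∧
      (∀ L' : ℝ, 0 < L' → Function.Periodic x L' → 2 * ξ ≤ L') ∧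
      (∀ t₀ : ℝ, ∃! t : ℝ, t ∈ Set.Ico t₀ (t₀ + 2 * ξ) ∧ IsLocalMax x t) ∧
      (∀ t₀ : ℝ, ∃! t : ℝ, t ∈ Set.Ico t₀ (t₀ + 2 * ξ) ∧ IsLocalMin x t) ∧
      (∀ t₀ : ℝ, deriv x t₀ = 0 → ∀ t : ℝ, x (t₀ + t) = x (t₀ - t)) := by
  have h2ξ : 0 < 2 * ξ := by linarith
  have hper : Function.Periodic x (2 * ξ) := fun t => by
    have := hsym (ξ + t)
    rw [show ξ - (ξ + t) = -t by ring, ← hev, ← add_assoc] at this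
    rw [← this]; congr 1; ring
  have hperk : ∀ (k : ℤ) t, x (t + k * (2 * ξ)) = x t := fun k t => hper.int_mul k t
  have hyper : ∀ (k : ℤ) t, y (t + k * (2 * ξ)) = y t := fun k t => by
    refine ((hx (t + k * (2 * ξ))).comp_add_const t (k * (2 * ξ))).unique ?_
    simpa only [hperk] using hx t
  have hodd : ∀ t, y (-t) = -y t := fun t => by
    have h2 := (hx (-(-t))).scomp (-t) (hasDerivAt_neg (-t))
    have h3 : x ∘ Neg.neg = x := funext fun s => (hev s).symm
    rw [h3] at h2
    simpa using (hx (-t)).unique h2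
  have hmono : StrictMonoOn x (Set.Icc 0 ξ) := fun u hu v hv huv =>
    lt_of_hasDerivAt_pos hx huv fun s hs => hy s ⟨hu.1.trans_lt hs.1, hs.2.trans_le hv.2⟩
  have habs : ∀ t, x |t| = x t := fun t => by
    rcases abs_choice t with h | h <;> rw [h]
    exact (hev t).symm
  have hrep : ∀ t, ∃ (k : ℤ) (s : ℝ), s ∈ Set.Ico (-ξ) ξ ∧ t = s + k * (2 * ξ) := fun t => by
    obtain ⟨m, hm, -⟩ := existsUnique_add_zsmul_mem_Ico h2ξ t (-ξ)
    refine ⟨-m, t + m • (2 * ξ), ⟨hm.1, by have := hm.2; linarith⟩, ?_⟩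
    rw [zsmul_eq_mul]; push_cast; ring
  have h0mem : (0 : ℝ) ∈ Set.Icc 0 ξ := ⟨le_rfl, hξ.le⟩
  have hξmem : ξ ∈ Set.Icc 0 ξ := ⟨hξ.le, le_rfl⟩
  have hmem : ∀ s ∈ Set.Ico (-ξ) ξ, |s| ∈ Set.Icc 0 ξ := fun s hs =>
    ⟨abs_nonneg s, abs_le.2 ⟨hs.1, hs.2.le⟩⟩
  have hbd : ∀ t, x 0 ≤ x t ∧ x t ≤ x ξ := fun t => by
    obtain ⟨k, s, hs, rfl⟩ := hrep t
    rw [hperk, ← habs s]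
    exact ⟨hmono.monotoneOn h0mem (hmem s hs) (abs_nonneg s),
      hmono.monotoneOn (hmem s hs) hξmem (hmem s hs).2⟩
  have hmin : ∀ t, x t = x 0 → ∃ k : ℤ, t = 0 + k * (2 * ξ) := fun t ht => by
    obtain ⟨k, s, hs, rfl⟩ := hrep t
    rw [hperk, ← habs s] at ht
    have := hmono.injOn (hmem s hs) h0mem ht
    exact ⟨k, by rw [abs_eq_zero.1 this]⟩
  have hmax : ∀ t, x t = x ξ → ∃ k : ℤ, t = -ξ + k * (2 * ξ) := fun t ht => by
    obtain ⟨k, s, hs, rfl⟩ := hrep t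
    rw [hperk, ← habs s] at ht
    have := hmono.injOn (hmem s hs) hξmem ht
    rcases (abs_eq hξ.le).1 this with h | h
    · exact absurd h hs.2.ne
    · exact ⟨k, by rw [h]⟩
  have hcrit : ∀ t, y t = 0 →
      (∃ k : ℤ, t = 0 + k * (2 * ξ)) ∨ ∃ k : ℤ, t = -ξ + k * (2 * ξ) := fun t ht => by
    obtain ⟨k, s, hs, rfl⟩ := hrep t
    rw [hyper] at ht
    rcases lt_trichotomy s 0 with h | rfl | h
    · rcases hs.1.eq_or_lt with h' | h'
      · exact Or.inr ⟨k, by rw [← h']⟩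
      · have := hy (-s) ⟨by linarith, by linarith⟩
        rw [hodd, ht] at this
        simp at this
    · exact Or.inl ⟨k, rfl⟩
    · exact absurd ht (hy s ⟨h, hs.2⟩).ne'
  have hxmin : ∀ k : ℤ, x (0 + k * (2 * ξ)) = x 0 := fun k => hperk k 0
  have hxmax : ∀ k : ℤ, x (-ξ + k * (2 * ξ)) = x ξ := fun k => by rw [hperk, ← hev]
  have hisol : ∀ (c : ℝ) (k : ℤ), ∃ᶠ u in nhds (c + k * (2 * ξ)),
      ¬ ∃ k' : ℤ, u = c + k' * (2 * ξ) := fun c k => by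
    have h1 : ∀ᶠ u in nhdsWithin (c + k * (2 * ξ)) (Set.Ioi (c + k * (2 * ξ))),
        ¬ ∃ k' : ℤ, u = c + k' * (2 * ξ) := by
      filter_upwards [Ioo_mem_nhdsGT (show c + k * (2 * ξ) < c + k * (2 * ξ) + 2 * ξ by linarith)]
      rintro u ⟨h1, h2⟩ ⟨k', rfl⟩
      have h3 : (k : ℝ) * (2 * ξ) < k' * (2 * ξ) := by linarith
      have h4 : (k' : ℝ) * (2 * ξ) < (k + 1) * (2 * ξ) := by linarith
      have h5 : k < k' := by exact_mod_cast lt_of_mul_lt_mul_right h3 h2ξ.le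
      have h6 : k' < k + 1 := by exact_mod_cast lt_of_mul_lt_mul_right h4 h2ξ.le
      omega
    exact h1.frequently.filter_mono nhdsWithin_le_nhds
  have hlocmax : ∀ t, IsLocalMax x t ↔ ∃ k : ℤ, t = -ξ + k * (2 * ξ) := fun t => by
    constructor
    · intro h
      rcases hcrit t (h.hasDerivAt_eq_zero (hx t)) with ⟨k, rfl⟩ | h'
      · obtain ⟨u, hu, hu'⟩ := ((hisol 0 k).and_eventually h).exists
        rw [hxmin] at hu'
        exact absurd (hmin u (le_antisymm hu' (hbd u).1)) hu
      · exact h'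
    · rintro ⟨k, rfl⟩
      exact Eventually.of_forall fun u => by rw [hxmax]; exact (hbd u).2
  have hlocmin : ∀ t, IsLocalMin x t ↔ ∃ k : ℤ, t = 0 + k * (2 * ξ) := fun t => by
    constructor
    · intro h
      rcases hcrit t (h.hasDerivAt_eq_zero (hx t)) with h' | ⟨k, rfl⟩
      · exact h'
      · obtain ⟨u, hu, hu'⟩ := ((hisol (-ξ) k).and_eventually h).exists
        rw [hxmax] at hu'
        exact absurd (hmax u (le_antisymm (hbd u).2 hu')) hu
    · rintro ⟨k, rfl⟩
      exact Eventually.of_forall fun u => by rw [hxmin]; exact (hbd u).1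
  have hunique : ∀ c t₀ : ℝ, ∃! t : ℝ, t ∈ Set.Ico t₀ (t₀ + 2 * ξ) ∧
      ∃ k : ℤ, t = c + k * (2 * ξ) := fun c t₀ => by
    obtain ⟨m, hm, huniq⟩ := existsUnique_add_zsmul_mem_Ico h2ξ c t₀
    simp only [zsmul_eq_mul] at hm huniq
    refine ⟨c + m * (2 * ξ), ⟨hm, m, rfl⟩, ?_⟩
    rintro _ ⟨ht, k, rfl⟩
    rw [huniq k ht]
  refine ⟨hbd, hper, fun L' hL' hL'per => ?_, fun t₀ => ?_, fun t₀ => ?_, fun t₀ h₀ t => ?_⟩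
  · obtain ⟨k, hk⟩ := hmin L' (by simpa using hL'per 0)
    rw [zero_add] at hk
    have hk0 : (0 : ℝ) < k := by
      rw [hk] at hL'
      exact pos_of_mul_pos_left hL' h2ξ.le
    have hk1 : (1 : ℝ) ≤ k := by exact_mod_cast hk0
    rw [hk]
    nlinarith
  · simp only [hlocmax]
    exact hunique _ _
  · simp only [hlocmin]
    exact hunique _ _
  · rw [(hx t₀).deriv] at h₀
    rcases hcrit t₀ h₀ with ⟨k, rfl⟩ | ⟨k, rfl⟩
    · rw [show 0 + k * (2 * ξ) + t = t + k * (2 * ξ) by ring,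
        show 0 + k * (2 * ξ) - t = -t + k * (2 * ξ) by ring, hperk, hperk, ← hev]
    · rw [show -ξ + k * (2 * ξ) + t = -(ξ - t) + k * (2 * ξ) by ring,
        show -ξ + k * (2 * ξ) - t = -(ξ + t) + k * (2 * ξ) by ring, hperk, hperk, ← hev, ← hev,
        hsym]

end Symmetric

section Truncation

variable {a a₀ l m : ℝ} {f : ℝ → ℝ}

/-- The function `f` on `[a, M]`, continued with slope one outside. -/
noncomputable def truncation (f : ℝ → ℝ) (a M v : ℝ) : ℝ :=
  f (max a (min v M)) + (v - max a (min v M))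

theorem truncation_eq {M v : ℝ} (hv : v ∈ Set.Icc a M) : truncation f a M v = f v := by
  rw [truncation, min_eq_left hv.2, max_eq_right hv.1, sub_self, add_zero]

theorem truncation_of_ge {M v : ℝ} (haM : a ≤ M) (hv : M ≤ v) :
    truncation f a M v = f M + (v - M) := by
  rw [truncation, min_eq_right hv, max_eq_right haM]

theorem exists_lipschitzWith_truncation (hf : ContDiffOn ℝ 1 f (Set.Ioi 0)) (ha : 0 < a) {M : ℝ}
    (haM : a ≤ M) : ∃ K : NNReal, LipschitzWith K (truncation f a M) := by
  obtain ⟨K, hK⟩ := (hf.mono fun v (hv : v ∈ Set.Icc a M) =>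
    ha.trans_le hv.1).exists_lipschitzOnWith one_ne_zero (convex_Icc a M) isCompact_Icc
  have h1 : LipschitzWith 1 fun v : ℝ => max a (min v M) :=
    (LipschitzWith.id.min_const M).const_max a
  have h2 : LipschitzWith (K * 1) fun v : ℝ => f (max a (min v M)) := by
    rw [← lipschitzOnWith_univ]
    exact hK.comp h1.lipschitzOnWith fun v _ =>
      ⟨le_max_left _ _, max_le haM (min_le_right _ _)⟩
  exact ⟨_, h2.add (LipschitzWith.id.sub h1)⟩

/-- Conservation of energy between two points where `x' = 0`. -/
theorem IsSolution.energy_eq {A : ℝ} {x y z h G : ℝ → ℝ} (hs : IsSolution A f x y z h)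
    (hG : ∀ v, HasDerivAt G (f v) v) {s t : ℝ} (hys : y s = 0) (hyt : y t = 0) :
    z s ^ 2 / 2 + G (x s) = z t ^ 2 / 2 + G (x t) := by
  have hd : ∀ t, HasDerivAt
      (fun t => z t ^ 2 / 2 - A / 2 * y t ^ 2 - h t * y t + G (x t)) 0 t := fun t => by
    have h1 := ((((hs.hz t).pow 2).div_const 2).sub (((hs.hy t).pow 2).const_mul (A / 2))).sub
      ((hs.hh t).mul (hs.hy t)) |>.add ((hG (x t)).comp t (hs.hx t))
    refine h1.congr_deriv ?_
    push_cast
    ring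
  have h2 := is_const_of_deriv_eq_zero (fun t => (hd t).differentiableAt)
    (fun t => (hd t).deriv) s t
  simpa [hys, hyt] using h2

theorem exists_integral_gt (hf : ContinuousOn f (Set.Ioi 0)) (ha : a ∈ Set.Ioo 0 a₀)
    (hmono : MonotoneOn f (Set.Ici a₀)) (hpos : ∀ v > a₀, 0 < f v) (C : ℝ) :
    ∃ M > a₀, C < ∫ s in a..M, f s := by
  have hint : ∀ {u v : ℝ}, a ≤ u → u ≤ v → IntervalIntegrable f MeasureTheory.volume u v :=
    fun hu huv => (hf.mono fun s hs => by
      rw [Set.uIcc_of_le huv] at hs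
      exact ha.1.trans_le (hu.trans hs.1)).intervalIntegrable
  have hε := hpos (a₀ + 1) (by linarith)
  set ε := f (a₀ + 1) with hεdef
  set D := ∫ s in a..a₀ + 1, f s
  set M := a₀ + 1 + (|C - D| + 1) / ε with hM
  have hM1 : a₀ + 1 ≤ M := by
    rw [hM]; have : 0 ≤ (|C - D| + 1) / ε := by positivity
    linarith
  have haa : a ≤ a₀ + 1 := by linarith [ha.2]
  refine ⟨M, by linarith, ?_⟩
  rw [← intervalIntegral.integral_add_adjacent_intervals (hint le_rfl haa) (hint haa hM1)]
  have h1 : ∫ s in (a₀ + 1)..M, ε ≤ ∫ s in (a₀ + 1)..M, f s :=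
    intervalIntegral.integral_mono_on hM1 (by simp) (hint haa hM1) fun s hs =>
      hmono (by simp) (by have := hs.1; simp only [Set.mem_Ici]; linarith) hs.1
  rw [intervalIntegral.integral_const, smul_eq_mul] at h1
  have h2 : (M - (a₀ + 1)) * ε = |C - D| + 1 := by rw [hM]; field_simp; ring
  linarith [le_abs_self (C - D)]

/-- Existence of a positive periodic solution with prescribed minimum `a` for the equation
`x'''' - (l + m) x'' = f(x)`. -/
theorem exists_symmetric_solution (hf : ContDiffOn ℝ 1 f (Set.Ioi 0)) (hl : 0 < l) (hm : 0 < m)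
    (ha : a ∈ Set.Ioo 0 a₀) (hneg : ∀ v ∈ Set.Ico a a₀, f v < 0)
    (hmono : MonotoneOn f (Set.Ici a₀)) (hpos : ∀ v > a₀, 0 < f v)
    (hg : ∀ v > 0, 0 < f v + l * m * v) :
    ∃ (x y z h : ℝ → ℝ) (g : ℝ → ℝ) (M ξ : ℝ), Continuous g ∧ (∀ v ∈ Set.Icc a M, g v = f v) ∧
      IsSolution (l + m) g x y z h ∧ x 0 = a ∧ x ξ ≤ M ∧ 0 < ξ ∧ (∀ t, x t = x (-t)) ∧
      (∀ t, x (ξ + t) = x (ξ - t)) ∧ ∀ s ∈ Set.Ioo 0 ξ, 0 < y s := by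
  obtain ⟨M, hM, hMint⟩ := exists_integral_gt hf.continuousOn ha hmono hpos ((m * a) ^ 2 / 2)
  have haM : a ≤ M := ha.2.le.trans hM.le
  set g := truncation f a M with hgdef
  obtain ⟨K, hK⟩ := exists_lipschitzWith_truncation hf ha.1 haM
  have hgc : Continuous g := hK.continuous
  have hgeq : ∀ v ∈ Set.Icc a M, g v = f v := fun v hv => truncation_eq hv
  have hgbig : ∀ v, M ≤ v → g v = f M + (v - M) := fun v hv => truncation_of_ge haM hv
  have hfM := hpos M hM
  have hgneg : ∀ v ∈ Set.Ico a a₀, g v < 0 := fun v hv => by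
    rw [hgeq v ⟨hv.1, hv.2.le.trans hM.le⟩]
    exact hneg v hv
  have hgpos : ∀ r > a₀, ∃ ε > 0, ∀ v ≥ r, ε ≤ g v := fun r hr => by
    refine ⟨min (f r) (f M), lt_min (hpos r hr) hfM, fun v hv => ?_⟩
    rcases le_total v M with hvM | hvM
    · rw [hgeq v ⟨by linarith [ha.2], hvM⟩]
      exact (min_le_left _ _).trans (hmono hr.le (hr.le.trans hv) hv)
    · rw [hgbig v hvM]
      linarith [min_le_right (f r) (f M)]
  have hglin : ∀ v ≥ a, 0 < g v + l * m * v := fun v hv => by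
    have hv0 : 0 < v := ha.1.trans_le hv
    rcases le_total v M with hvM | hvM
    · rw [hgeq v ⟨hv, hvM⟩]
      exact hg v hv0
    · rw [hgbig v hvM]
      have : 0 < l * m * v := by positivity
      linarith
  obtain ⟨x, y, z, h, ξ, hs, hx0, hy0, hz0, hz0', hh0, hξ, hyξ, hhξ, hlt⟩ :=
    exists_shooting hK hl hm ha hgneg hgpos hglin
  refine ⟨x, y, z, h, g, M, ξ, hgc, hgeq, hs, hx0, ?_, hξ, fun t => ?_,
    hs.reflect hK hyξ hhξ, hlt⟩
  · by_contra! hcon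
    have hG : ∀ v, HasDerivAt (fun v => ∫ s in a..v, g s) (g v) v := fun v =>
      (hgc.integral_hasStrictDerivAt a v).hasDerivAt
    have henergy := hs.energy_eq hG hy0 hyξ
    simp only [hx0, intervalIntegral.integral_same, add_zero] at henergy
    have h1 : ∫ s in a..M, g s = ∫ s in a..M, f s :=
      intervalIntegral.integral_congr fun s hs' => hgeq s (by rwa [Set.uIcc_of_le haM] at hs')
    have h2 := le_sub_of_hasDerivAt_ge (ε := 0) hG hcon.le fun s hs' => by
      rw [hgbig s hs'.1.le]
      linarith [hs'.1]
    have h3 : z 0 ^ 2 ≤ (m * a) ^ 2 := by gcongr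
    have h4 := sq_nonneg (z ξ)
    simp only [h1] at h2
    linarith
  · simpa using hs.reflect hK hy0 hh0 t

end Truncation

section Nonlinearity

variable {n : ℕ}

theorem four_lt_cast (hn : 5 ≤ n) : (4 : ℝ) < n := by exact_mod_cast hn

theorem p_sub_one (hn : 5 ≤ n) : Paper.p n - 1 = 8 / ((n : ℝ) - 4) := by
  have : (n : ℝ) - 4 ≠ 0 := by linarith [four_lt_cast hn]
  rw [Paper.p]
  field_simp
  ring

theorem p_sub_one_pos (hn : 5 ≤ n) : 0 < Paper.p n - 1 := by
  rw [p_sub_one hn]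
  have : 0 < (n : ℝ) - 4 := by linarith [four_lt_cast hn]
  positivity

theorem a₀_pos (hn : 5 ≤ n) : 0 < Paper.a₀ n := by
  have := four_lt_cast hn
  have : 0 < (n : ℝ) - 4 := by linarith
  rw [Paper.a₀]
  positivity

theorem a₀_rpow (hn : 5 ≤ n) : Paper.a₀ n ^ (Paper.p n - 1) = Paper.B n := by
  have h4 := four_lt_cast hn
  have h : 0 < (n : ℝ) - 4 := by linarith
  rw [Paper.a₀, ← Real.rpow_mul (by positivity), p_sub_one hn,
    show ((n : ℝ) - 4) / 4 * (8 / ((n : ℝ) - 4)) = (2 : ℕ) by field_simp; norm_num,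
    Real.rpow_natCast, Paper.B]
  ring

theorem f_of_pos {v : ℝ} (hv : 0 < v) :
    Paper.f n v = (v ^ (Paper.p n - 1) - Paper.B n) * v := by
  rw [Paper.f, abs_of_pos hv]
  ring

theorem f_neg (hn : 5 ≤ n) {v : ℝ} (hv : 0 < v) (hva : v < Paper.a₀ n) : Paper.f n v < 0 := by
  have := Real.rpow_lt_rpow hv.le hva (p_sub_one_pos hn)
  rw [a₀_rpow hn] at this
  rw [f_of_pos hv]
  exact mul_neg_of_neg_of_pos (by linarith) hv

theorem f_pos (hn : 5 ≤ n) {v : ℝ} (hva : Paper.a₀ n < v) : 0 < Paper.f n v := by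
  have h0 := a₀_pos hn
  have := Real.rpow_lt_rpow h0.le hva (p_sub_one_pos hn)
  rw [a₀_rpow hn] at this
  rw [f_of_pos (h0.trans hva)]
  exact mul_pos (by linarith) (h0.trans hva)

theorem monotoneOn_f (hn : 5 ≤ n) : MonotoneOn (Paper.f n) (Set.Ici (Paper.a₀ n)) := by
  intro u hu v hv huv
  have h0 := a₀_pos hn
  have hu0 : 0 < u := h0.trans_le hu
  have h1 := Real.rpow_le_rpow h0.le hu (p_sub_one_pos hn).le
  have h2 := Real.rpow_le_rpow hu0.le huv (p_sub_one_pos hn).le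
  rw [a₀_rpow hn] at h1
  rw [f_of_pos hu0, f_of_pos (hu0.trans_le huv)]
  exact mul_le_mul (by linarith) huv hu0.le (by linarith)

theorem contDiffOn_f : ContDiffOn ℝ 1 (Paper.f n) (Set.Ioi 0) := by
  have h : ContDiffOn ℝ 1 (fun v : ℝ => (v ^ (Paper.p n - 1) - Paper.B n) * v) (Set.Ioi 0) :=
    ((contDiffOn_id.rpow_const_of_ne fun v hv => ne_of_gt hv).sub contDiffOn_const).mul
      contDiffOn_id
  exact h.congr fun v hv => f_of_pos hv

end Nonlinearity

section Regularity

variable {A : ℝ} {f x y z h : ℝ → ℝ}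

theorem IsSolution.iteratedDeriv_two (hs : IsSolution A f x y z h) : iteratedDeriv 2 x = z := by
  rw [iteratedDeriv_succ, iteratedDeriv_one, funext fun t => (hs.hx t).deriv]
  exact funext fun t => (hs.hy t).deriv

theorem IsSolution.iteratedDeriv_four (hs : IsSolution A f x y z h) :
    iteratedDeriv 4 x = fun t => A * z t + f (x t) := by
  rw [iteratedDeriv_succ, iteratedDeriv_succ, hs.iteratedDeriv_two,
    funext fun t => (hs.hz t).deriv]
  exact funext fun t => (((hs.hy t).const_mul A).add (hs.hh t)).deriv

theorem IsSolution.contDiff (hs : IsSolution A f x y z h) (hf : Continuous f) :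
    ContDiff ℝ 4 x := by
  have hxc : Continuous x := continuous_iff_continuousAt.2 fun t => (hs.hx t).continuousAt
  have h1 : ∀ {g g' : ℝ → ℝ} {k : ℕ}, (∀ t, HasDerivAt g (g' t) t) → ContDiff ℝ k g' →
      ContDiff ℝ (k + 1) g := fun hg hg' =>
    contDiff_succ_iff_deriv.2 ⟨fun t => (hg t).differentiableAt, by simp,
      by rwa [funext fun t => (hg t).deriv]⟩
  have hh : ContDiff ℝ (0 + 1) h :=
    h1 (k := 0) hs.hh (contDiff_zero.2 (hf.comp hxc))
  have hzc : Continuous z := continuous_iff_continuousAt.2 fun t => (hs.hz t).continuousAt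
  have hy : ContDiff ℝ (0 + 1) y := h1 (k := 0) hs.hy (contDiff_zero.2 hzc)
  have hz : ContDiff ℝ ((1 : ℕ) + 1) z :=
    h1 hs.hz ((contDiff_const.mul (by simpa using hy)).add (by simpa using hh))
  have hy' : ContDiff ℝ ((2 : ℕ) + 1) y := h1 hs.hy (by convert hz; norm_num)
  have hx : ContDiff ℝ ((3 : ℕ) + 1) x := h1 hs.hx (by convert hy'; norm_num)
  convert hx
  norm_num

end Regularity

/-- **Theorem 1 (ii), existence part.** For every `a ∈ (0, a₀)` there is a bounded `C⁴`
solution of `v'''' - A v'' - f(v) = 0` with minimal value `a`, which is periodic with a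
minimal period `L > 0`, has exactly one local maximum point and exactly one local minimum
point per interval of length `L`, and is symmetric with respect to each of its critical
points. -/
theorem existence_periodic_solution (n : ℕ) (hn : 5 ≤ n) (a : ℝ)
    (ha : a ∈ Set.Ioo 0 (Paper.a₀ n)) :
    ∃ v : ℝ → ℝ, ContDiff ℝ 4 v ∧
      (∀ t : ℝ, iteratedDeriv 4 v t - Paper.A n * iteratedDeriv 2 v t
        - Paper.f n (v t) = 0) ∧
      (∃ M : ℝ, ∀ t : ℝ, |v t| ≤ M) ∧
      (∀ t : ℝ, a ≤ v t) ∧ (∃ t : ℝ, v t = a) ∧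
      ∃ L : ℝ, 0 < L ∧ Function.Periodic v L ∧
        (∀ L' : ℝ, 0 < L' → Function.Periodic v L' → L ≤ L') ∧
        (∀ t₀ : ℝ, ∃! t : ℝ, t ∈ Set.Ico t₀ (t₀ + L) ∧ IsLocalMax v t) ∧
        (∀ t₀ : ℝ, ∃! t : ℝ, t ∈ Set.Ico t₀ (t₀ + L) ∧ IsLocalMin v t) ∧
        (∀ t₀ : ℝ, deriv v t₀ = 0 → ∀ t : ℝ, v (t₀ + t) = v (t₀ - t)) := by
  have h4 := four_lt_cast hn
  have hn4 : 0 < (n : ℝ) - 4 := by linarith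
  have hA : (n : ℝ) ^ 2 / 4 + ((n : ℝ) - 4) ^ 2 / 4 = Paper.A n := by rw [Paper.A]; ring
  have hB : (n : ℝ) ^ 2 / 4 * (((n : ℝ) - 4) ^ 2 / 4) = Paper.B n := by rw [Paper.B]; ring
  obtain ⟨x, y, z, h, g, M, ξ, hg, hgeq, hs, hx0, hxξ, hξ, hev, hsym, hy⟩ :=
    exists_symmetric_solution (l := (n : ℝ) ^ 2 / 4) (m := ((n : ℝ) - 4) ^ 2 / 4)
      (contDiffOn_f (n := n)) (by positivity) (by positivity) ha
      (fun v hv => f_neg hn (ha.1.trans_le hv.1) hv.2) (monotoneOn_f hn)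
      (fun v hv => f_pos hn hv) fun v hv => by
        rw [hB, f_of_pos hv, ← add_mul, sub_add_cancel]
        positivity
  rw [hA] at hs
  obtain ⟨hbd, hrest⟩ := periodic_of_symmetric hs.hx hξ hev hsym hy
  have hmem : ∀ t, x t ∈ Set.Icc a M := fun t => ⟨hx0 ▸ (hbd t).1, (hbd t).2.trans hxξ⟩
  refine ⟨x, hs.contDiff hg, fun t => ?_, ⟨M, fun t => ?_⟩, fun t => (hmem t).1, ⟨0, hx0⟩, 2 * ξ,
    by linarith, hrest⟩
  · simp only [hs.iteratedDeriv_four, hs.iteratedDeriv_two, hgeq _ (hmem t)]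
    ring
  · rw [abs_of_pos (ha.1.trans_le (hmem t).1)]
    exact (hmem t).2
end

section
/- Let a ∈ (0, a₀) and let v, w ∈ C⁴(ℝ) be bounded solutions of the ODE v'''' − A·v'' − f(v) = 0 such that both v and w attain the minimal value a, i.e. min_{t ∈ ℝ} v(t) = min_{t ∈ ℝ} w(t) = a. Then w is a translate of v: there exists T ∈ ℝ such that w(t) = v(t + T) for all t ∈ ℝ. -/
open Real Filter

/-- A differentiable function with `y' ≥ k y` on `[0, T]` and `y 0 ≥ 0` is nonnegative there. -/
lemma nonneg_of_mul_le_deriv {y y' : ℝ → ℝ} {k T : ℝ} (hy : ∀ t, HasDerivAt y (y' t) t)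
    (hk : ∀ t ∈ Set.Icc 0 T, k * y t ≤ y' t) (h0 : 0 ≤ y 0) :
    ∀ t ∈ Set.Icc 0 T, 0 ≤ y t := by
  have hd : ∀ t, HasDerivAt (fun t => exp (-k * t) * y t)
      (exp (-k * t) * (y' t - k * y t)) t := by
    intro t
    have h1 : HasDerivAt (fun t => exp (-k * t)) (exp (-k * t) * (-k)) t := by
      simpa using ((hasDerivAt_id t).const_mul (-k)).exp
    exact (h1.mul (hy t)).congr_deriv (by ring)
  have hmono : MonotoneOn (fun t => exp (-k * t) * y t) (Set.Icc 0 T) := by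
    refine monotoneOn_of_deriv_nonneg (convex_Icc 0 T)
      (fun t _ => (hd t).continuousAt.continuousWithinAt)
      (fun t _ => (hd t).differentiableAt.differentiableWithinAt) fun t ht => ?_
    rw [(hd t).deriv]
    exact mul_nonneg (exp_pos _).le (sub_nonneg.2 (hk t (interior_subset ht)))
  intro t ht
  have h := hmono (Set.left_mem_Icc.2 (ht.1.trans ht.2)) ht ht.1
  simp only [mul_zero, exp_zero, one_mul] at h
  exact nonneg_of_mul_nonneg_right (h0.trans h) (exp_pos _)

/-- `x` solves `x'''' - (l² + c²) x'' + l² c² x = h`, where `x₁, x₂, x₃` are its first three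
derivatives and `h` has the sign of `x` and is bounded by `K |x|`. -/
structure IsForcedSolution (l c K : ℝ) (x x₁ x₂ x₃ h : ℝ → ℝ) : Prop where
  deriv_zero : ∀ t, HasDerivAt x (x₁ t) t
  deriv_one : ∀ t, HasDerivAt x₁ (x₂ t) t
  deriv_two : ∀ t, HasDerivAt x₂ (x₃ t) t
  deriv_three : ∀ t, HasDerivAt x₃ ((l ^ 2 + c ^ 2) * x₂ t - l ^ 2 * c ^ 2 * x t + h t) t
  nonneg : ∀ t, 0 ≤ x t → 0 ≤ h t
  nonpos : ∀ t, x t ≤ 0 → h t ≤ 0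
  abs_le : ∀ t, |h t| ≤ K * |x t|

namespace IsForcedSolution

variable {l c K : ℝ} {x x₁ x₂ x₃ h : ℝ → ℝ}

lemma neg (H : IsForcedSolution l c K x x₁ x₂ x₃ h) :
    IsForcedSolution l c K (fun t => -x t) (fun t => -x₁ t) (fun t => -x₂ t) (fun t => -x₃ t)
      (fun t => -h t) where
  deriv_zero t := (H.deriv_zero t).neg
  deriv_one t := (H.deriv_one t).neg
  deriv_two t := (H.deriv_two t).neg
  deriv_three t := (H.deriv_three t).neg.congr_deriv (by ring)
  nonneg t ht := neg_nonneg.2 (H.nonpos t (neg_nonneg.1 ht))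
  nonpos t ht := neg_nonpos.2 (H.nonneg t (neg_nonpos.1 ht))
  abs_le t := by simpa using H.abs_le t

lemma comp_neg (H : IsForcedSolution l c K x x₁ x₂ x₃ h) :
    IsForcedSolution l c K (fun t => x (-t)) (fun t => -x₁ (-t)) (fun t => x₂ (-t))
      (fun t => -x₃ (-t)) (fun t => h (-t)) where
  deriv_zero t := ((H.deriv_zero (-t)).comp t (hasDerivAt_neg t)).congr_deriv (by ring)
  deriv_one t := ((H.deriv_one (-t)).comp t (hasDerivAt_neg t)).neg.congr_deriv (by ring)
  deriv_two t := ((H.deriv_two (-t)).comp t (hasDerivAt_neg t)).congr_deriv (by ring)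
  deriv_three t :=
    ((H.deriv_three (-t)).comp t (hasDerivAt_neg t)).neg.congr_deriv (by ring)
  nonneg t := H.nonneg (-t)
  nonpos t := H.nonpos (-t)
  abs_le t := H.abs_le (-t)

lemma eq_zero_of_nonneg_time (H : IsForcedSolution l c K x x₁ x₂ x₃ h)
    (h0 : x 0 = 0) (h1 : x₁ 0 = 0) (h2 : x₂ 0 = 0) (h3 : x₃ 0 = 0) {t : ℝ} (ht : 0 ≤ t) :
    x t = 0 := by
  have hd : ∀ s, HasDerivAt (fun s => (x s, x₁ s, x₂ s, x₃ s))
      (x₁ s, x₂ s, x₃ s, (l ^ 2 + c ^ 2) * x₂ s - l ^ 2 * c ^ 2 * x s + h s) s := fun s =>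
    (H.deriv_zero s).prodMk ((H.deriv_one s).prodMk ((H.deriv_two s).prodMk (H.deriv_three s)))
  have key := eq_zero_of_abs_deriv_le_mul_abs_self_of_eq_zero_right (a := 0) (b := t)
    (K := 1 + (l ^ 2 + c ^ 2) + l ^ 2 * c ^ 2 + |K|)
    (fun s _ => (hd s).continuousAt.continuousWithinAt)
    (fun s _ => (hd s).hasDerivWithinAt) (by simp [h0, h1, h2, h3]) ?_ t ⟨ht, le_rfl⟩
  · exact congrArg Prod.fst key
  · intro s _
    set N := ‖(x s, x₁ s, x₂ s, x₃ s)‖ with hN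
    have hx0 : |x s| ≤ N := by simp [hN, Prod.norm_def]
    have hx1 : |x₁ s| ≤ N := by simp [hN, Prod.norm_def]
    have hx2 : |x₂ s| ≤ N := by simp [hN, Prod.norm_def]
    have hx3 : |x₃ s| ≤ N := by simp [hN, Prod.norm_def]
    have hN0 : 0 ≤ N := norm_nonneg _
    have hh : |h s| ≤ |K| * N := (H.abs_le s).trans
      (mul_le_mul (le_abs_self K) hx0 (abs_nonneg _) (abs_nonneg _))
    have hlc : 0 ≤ l ^ 2 + c ^ 2 := by positivity
    have hlc' : 0 ≤ l ^ 2 * c ^ 2 := by positivity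
    have e2 : |(l ^ 2 + c ^ 2) * x₂ s| ≤ (l ^ 2 + c ^ 2) * N := by
      rw [abs_mul, abs_of_nonneg hlc]
      gcongr
    have e0 : |l ^ 2 * c ^ 2 * x s| ≤ l ^ 2 * c ^ 2 * N := by
      rw [abs_mul, abs_of_nonneg hlc']
      gcongr
    have p1 := mul_nonneg hlc hN0
    have p2 := mul_nonneg hlc' hN0
    have p3 := mul_nonneg (abs_nonneg K) hN0
    have hexp : (1 + (l ^ 2 + c ^ 2) + l ^ 2 * c ^ 2 + |K|) * N =
      N + (l ^ 2 + c ^ 2) * N + l ^ 2 * c ^ 2 * N + |K| * N := by ring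
    rw [hexp]
    have t1 := abs_add_le ((l ^ 2 + c ^ 2) * x₂ s - l ^ 2 * c ^ 2 * x s) (h s)
    have t2 := abs_sub ((l ^ 2 + c ^ 2) * x₂ s) (l ^ 2 * c ^ 2 * x s)
    refine norm_prod_le_iff.2 ⟨?_, norm_prod_le_iff.2 ⟨?_, norm_prod_le_iff.2 ⟨?_, ?_⟩⟩⟩ <;>
      simp only [Real.norm_eq_abs] <;> linarith

/-- If `x ≥ 0` on `[0, T]`, then `x'' - l² x` stays nonnegative there. -/
lemma mul_le_deriv_two (H : IsForcedSolution l c K x x₁ x₂ x₃ h) (hc : 0 ≤ c)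
    (h0 : x 0 = 0) (h1 : x₁ 0 = 0) (h2 : 0 ≤ x₂ 0) (h3 : 0 ≤ x₃ 0) {T : ℝ}
    (hx : ∀ t ∈ Set.Icc 0 T, 0 ≤ x t) :
    ∀ t ∈ Set.Icc 0 T, l ^ 2 * x t ≤ x₂ t := by
  have hψ : ∀ t, HasDerivAt (fun t => x₂ t - l ^ 2 * x t) (x₃ t - l ^ 2 * x₁ t) t := fun t =>
    (H.deriv_two t).sub ((H.deriv_zero t).const_mul _)
  have hψ' : ∀ t, HasDerivAt (fun t => x₃ t - l ^ 2 * x₁ t)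
      ((l ^ 2 + c ^ 2) * x₂ t - l ^ 2 * c ^ 2 * x t + h t - l ^ 2 * x₂ t) t := fun t =>
    (H.deriv_three t).sub ((H.deriv_one t).const_mul _)
  have hχ := nonneg_of_mul_le_deriv (k := c) (T := T)
    (fun t => (hψ' t).add ((hψ t).const_mul c))
    (fun t ht => by
      have := H.nonneg t (hx t ht)
      simp only [Pi.add_apply]
      nlinarith)
    (by simp only [Pi.add_apply, h0, h1]; nlinarith [mul_nonneg hc h2])
  have hnn := nonneg_of_mul_le_deriv (k := -c) (T := T) hψ
    (fun t ht => by
      have := hχ t ht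
      simp only [Pi.add_apply] at this
      linarith)
    (by simpa [h0] using h2)
  intro t ht
  linarith [hnn t ht]

lemma deriv_pos (H : IsForcedSolution l c K x x₁ x₂ x₃ h) (hc : 0 ≤ c)
    (h0 : x 0 = 0) (h1 : x₁ 0 = 0) (h2 : 0 ≤ x₂ 0) (h3 : 0 ≤ x₃ 0) {ε : ℝ}
    (hε : 0 < ε) (hpos : ∀ t ∈ Set.Ioo 0 ε, 0 < x₂ t) :
    (∀ t, 0 < t → 0 < x₁ t) ∧ ∀ t, 0 ≤ t → 0 ≤ x₂ t := by
  have c0 : Continuous x := continuous_iff_continuousAt.2 fun t => (H.deriv_zero t).continuousAt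
  have c1 : Continuous x₁ := continuous_iff_continuousAt.2 fun t => (H.deriv_one t).continuousAt
  have hsmall : ∀ t ∈ Set.Ioc 0 ε, 0 < x₁ t := by
    have hm : StrictMonoOn x₁ (Set.Icc 0 ε) :=
      strictMonoOn_of_deriv_pos (convex_Icc 0 ε) c1.continuousOn fun t ht => by
        rw [interior_Icc] at ht
        rw [(H.deriv_one t).deriv]
        exact hpos t ht
    intro t ht
    have := hm (Set.left_mem_Icc.2 hε.le) (Set.Ioc_subset_Icc_self ht) ht.1
    rwa [h1] at this
  have hstep : ∀ T, (∀ t ∈ Set.Ioo 0 T, 0 < x₁ t) → ∀ t ∈ Set.Icc 0 T, 0 ≤ x₂ t := by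
    intro T hT
    have hm : MonotoneOn x (Set.Icc 0 T) :=
      (strictMonoOn_of_deriv_pos (convex_Icc 0 T) c0.continuousOn fun t ht => by
        rw [interior_Icc] at ht
        rw [(H.deriv_zero t).deriv]
        exact hT t ht).monotoneOn
    have hx : ∀ t ∈ Set.Icc 0 T, 0 ≤ x t := fun t ht => by
      have := hm (Set.left_mem_Icc.2 (ht.1.trans ht.2)) ht ht.1
      rwa [h0] at this
    intro t ht
    exact (mul_nonneg (sq_nonneg l) (hx t ht)).trans
      (H.mul_le_deriv_two hc h0 h1 h2 h3 hx t ht)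
  have hall : ∀ t, 0 < t → 0 < x₁ t := by
    by_contra! hne
    obtain ⟨t₁, ht₁, hxt₁⟩ := hne
    set S := Set.Ici ε ∩ {t | x₁ t ≤ 0}
    have hSc : IsClosed S := isClosed_Ici.inter (isClosed_le c1 continuous_const)
    have hSb : BddBelow S := ⟨ε, fun t ht => ht.1⟩
    have hmem : ∀ t, 0 < t → x₁ t ≤ 0 → t ∈ S := fun t ht hxt => by
      refine ⟨?_, hxt⟩
      by_contra hlt
      exact (hsmall t ⟨ht, (not_le.1 hlt).le⟩).not_ge hxt
    have hT := hSc.csInf_mem ⟨t₁, hmem t₁ ht₁ hxt₁⟩ hSb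
    set T := sInf S
    have hTpos : ∀ t ∈ Set.Ioo 0 T, 0 < x₁ t := fun t ht => by
      by_contra hle
      exact (csInf_le hSb (hmem t ht.1 (not_lt.1 hle))).not_gt ht.2
    have hm : MonotoneOn x₁ (Set.Icc ε T) :=
      monotoneOn_of_deriv_nonneg (convex_Icc ε T) c1.continuousOn
        (fun t _ => (H.deriv_one t).differentiableAt.differentiableWithinAt) fun t ht => by
          have ht := interior_subset ht
          rw [(H.deriv_one t).deriv]
          exact hstep T hTpos t ⟨hε.le.trans ht.1, ht.2⟩
    have h5 := hm ⟨le_rfl, hT.1⟩ ⟨hT.1, le_rfl⟩ hT.1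
    have h6 := hsmall ε ⟨hε, le_rfl⟩
    exact (h6.trans_le h5).not_ge hT.2
  exact ⟨hall, fun t ht => hstep t (fun s hs => hall s hs.1) t ⟨ht, le_rfl⟩⟩

/-- A solution with `x = x' = 0`, `x'', x''' ≥ 0` at `0` and `x'' > 0` just after `0` is
increasing and convex for positive times, hence unbounded. -/
lemma not_bounded (H : IsForcedSolution l c K x x₁ x₂ x₃ h) (hc : 0 ≤ c)
    (h0 : x 0 = 0) (h1 : x₁ 0 = 0) (h2 : 0 ≤ x₂ 0) (h3 : 0 ≤ x₃ 0) {ε : ℝ}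
    (hε : 0 < ε) (hpos : ∀ t ∈ Set.Ioo 0 ε, 0 < x₂ t) {M : ℝ} (hM : ∀ t, |x t| ≤ M) :
    False := by
  obtain ⟨hx₁, hx₂⟩ := H.deriv_pos hc h0 h1 h2 h3 hε hpos
  have hm : ∀ t, 1 ≤ t → x₁ 1 ≤ x₁ t := by
    have hm : MonotoneOn x₁ (Set.Ici 1) :=
      monotoneOn_of_deriv_nonneg (convex_Ici 1)
        (fun t _ => (H.deriv_one t).continuousAt.continuousWithinAt)
        (fun t _ => (H.deriv_one t).differentiableAt.differentiableWithinAt) fun t ht => by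
          have ht := interior_subset ht
          rw [(H.deriv_one t).deriv]
          exact hx₂ t (zero_le_one.trans ht)
    exact fun t ht => hm Set.self_mem_Ici ht ht
  have hd : 0 < x₁ 1 := hx₁ 1 one_pos
  have hM0 : 0 ≤ M := (abs_nonneg _).trans (hM 0)
  have hr : 0 ≤ (2 * M + 1) / x₁ 1 := div_nonneg (by linarith) hd.le
  have hlin := (convex_Ici (1 : ℝ)).mul_sub_le_image_sub_of_le_deriv (f := x) (C := x₁ 1)
    (fun t _ => (H.deriv_zero t).continuousAt.continuousWithinAt)
    (fun t _ => (H.deriv_zero t).differentiableAt.differentiableWithinAt)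
    (fun t ht => by
      rw [(H.deriv_zero t).deriv]
      exact hm t (interior_subset ht))
    1 Set.self_mem_Ici (1 + (2 * M + 1) / x₁ 1)
    (Set.mem_Ici.2 (by linarith)) (by linarith)
  rw [add_sub_cancel_left, mul_div_cancel₀ _ hd.ne'] at hlin
  have b1 := _root_.abs_le.1 (hM 1)
  have b2 := _root_.abs_le.1 (hM (1 + (2 * M + 1) / x₁ 1))
  linarith [b1.1, b2.2]

lemma initial_eq_zero (H : IsForcedSolution l c K x x₁ x₂ x₃ h) (hc : 0 ≤ c)
    (h0 : x 0 = 0) (h1 : x₁ 0 = 0) (h2 : 0 ≤ x₂ 0) (h3 : 0 ≤ x₃ 0) {M : ℝ}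
    (hM : ∀ t, |x t| ≤ M) : x₂ 0 = 0 ∧ x₃ 0 = 0 := by
  by_contra hne
  suffices ∃ ε > 0, ∀ t ∈ Set.Ioo 0 ε, 0 < x₂ t by
    obtain ⟨ε, hε, hpos⟩ := this
    exact H.not_bounded hc h0 h1 h2 h3 hε hpos hM
  rcases h2.lt_or_eq with hp | hz
  · obtain ⟨ε, hε, hb⟩ := Metric.eventually_nhds_iff.1
      ((H.deriv_two 0).continuousAt.eventually_const_lt hp)
    refine ⟨ε, hε, fun t ht => hb ?_⟩
    rw [Real.dist_eq, sub_zero, abs_of_pos ht.1]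
    exact ht.2
  · have hp : 0 < x₃ 0 := h3.lt_of_ne fun hz3 => hne ⟨hz.symm, hz3.symm⟩
    obtain ⟨ε, hε, hb⟩ := Metric.eventually_nhds_iff.1
      ((H.deriv_three 0).continuousAt.eventually_const_lt hp)
    refine ⟨ε, hε, fun t ht => ?_⟩
    have hm : StrictMonoOn x₂ (Set.Icc 0 t) :=
      strictMonoOn_of_deriv_pos (convex_Icc 0 t)
        (fun s _ => (H.deriv_two s).continuousAt.continuousWithinAt) fun s hs => by
          rw [interior_Icc] at hs
          rw [(H.deriv_two s).deriv]
          refine hb ?_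
          rw [Real.dist_eq, sub_zero, abs_of_pos hs.1]
          exact hs.2.trans ht.2
    have := hm (Set.left_mem_Icc.2 ht.1.le) (Set.right_mem_Icc.2 ht.1.le) ht.1
    rwa [← hz] at this

/-- A bounded solution with a double zero at the origin vanishes identically. -/
theorem eq_zero (H : IsForcedSolution l c K x x₁ x₂ x₃ h) (hc : 0 ≤ c)
    (h0 : x 0 = 0) (h1 : x₁ 0 = 0) {M : ℝ} (hM : ∀ t, |x t| ≤ M) (t : ℝ) : x t = 0 := by
  have h23 : x₂ 0 = 0 ∧ x₃ 0 = 0 := by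
    rcases le_total 0 (x₂ 0) with h2 | h2 <;> rcases le_total 0 (x₃ 0) with h3 | h3
    · exact H.initial_eq_zero hc h0 h1 h2 h3 hM
    · simpa using H.comp_neg.initial_eq_zero hc (by simpa using h0) (by simpa using h1)
        (by simpa using h2) (by simpa using h3) (fun t => hM (-t))
    · simpa using H.neg.comp_neg.initial_eq_zero hc (by simpa using h0) (by simpa using h1)
        (by simpa using h2) (by simpa using h3) (fun t => by simpa using hM (-t))
    · simpa using H.neg.initial_eq_zero hc (by simpa using h0) (by simpa using h1)
        (by simpa using h2) (by simpa using h3) (fun t => by simpa using hM t)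
  rcases le_total 0 t with ht | ht
  · exact H.eq_zero_of_nonneg_time h0 h1 h23.1 h23.2 ht
  · simpa using H.comp_neg.eq_zero_of_nonneg_time (t := -t) (by simpa using h0)
      (by simpa using h1) (by simpa using h23.1) (by simpa using h23.2) (by linarith)

end IsForcedSolution

lemma Paper.f_eq_of_pos_s2 (n : ℕ) {s : ℝ} (hs : 0 < s) :
    Paper.f n s = s ^ Paper.p n - Paper.B n * s := by
  rw [Paper.f, abs_of_pos hs, Real.rpow_sub_one hs.ne', div_mul_cancel₀ _ hs.ne']

lemma rpow_sub_rpow_abs_le {q M : ℝ} (hq : 1 ≤ q) {s r : ℝ} (hs : s ∈ Set.Icc 0 M)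
    (hr : r ∈ Set.Icc 0 M) : |s ^ q - r ^ q| ≤ q * M ^ (q - 1) * |s - r| := by
  refine (convex_Icc 0 M).norm_image_sub_le_of_norm_hasDerivWithin_le (f := fun y => y ^ q)
    (f' := fun y => q * y ^ (q - 1))
    (fun y _ => (Real.hasDerivAt_rpow_const (Or.inr hq)).hasDerivWithinAt) (fun y hy => ?_) hr hs
  rw [Real.norm_eq_abs, abs_of_nonneg (mul_nonneg (by linarith) (rpow_nonneg hy.1 _))]
  exact mul_le_mul_of_nonneg_left (rpow_le_rpow hy.1 hy.2 (by linarith)) (by linarith)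

lemma hasDerivAt_iteratedDeriv_of_contDiff {u : ℝ → ℝ} {m k : ℕ} (hu : ContDiff ℝ m u)
    (hk : k < m) (t : ℝ) : HasDerivAt (iteratedDeriv k u) (iteratedDeriv (k + 1) u t) t := by
  rw [iteratedDeriv_succ]
  exact (hu.differentiable_iteratedDeriv k (by exact_mod_cast hk) t).hasDerivAt

/-- **Theorem 1 (ii), uniqueness part.** For `a ∈ (0, a₀)`, any two bounded `C⁴` solutions
of `v'''' - A v'' - f(v) = 0` with minimal value `a` agree up to a translation. -/
theorem uniqueness_periodic_solution (n : ℕ) (hn : 5 ≤ n) (a : ℝ)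
    (ha : a ∈ Set.Ioo 0 (Paper.a₀ n)) (v w : ℝ → ℝ)
    (hvreg : ContDiff ℝ 4 v) (hwreg : ContDiff ℝ 4 w)
    (hvode : ∀ t : ℝ, iteratedDeriv 4 v t - Paper.A n * iteratedDeriv 2 v t
      - Paper.f n (v t) = 0)
    (hwode : ∀ t : ℝ, iteratedDeriv 4 w t - Paper.A n * iteratedDeriv 2 w t
      - Paper.f n (w t) = 0)
    (hvbd : ∃ M : ℝ, ∀ t : ℝ, |v t| ≤ M) (hwbd : ∃ M : ℝ, ∀ t : ℝ, |w t| ≤ M)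
    (hvmin : (∀ t : ℝ, a ≤ v t) ∧ ∃ t : ℝ, v t = a)
    (hwmin : (∀ t : ℝ, a ≤ w t) ∧ ∃ t : ℝ, w t = a) :
    ∃ T : ℝ, ∀ t : ℝ, w t = v (t + T) := by
  obtain ⟨ha, -⟩ := ha
  obtain ⟨hva, tv, htv⟩ := hvmin
  obtain ⟨hwa, tw, htw⟩ := hwmin
  obtain ⟨Mv, hMv⟩ := hvbd
  obtain ⟨Mw, hMw⟩ := hwbd
  have hn' : (5 : ℝ) ≤ n := by exact_mod_cast hn
  have hp : 1 ≤ Paper.p n := by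
    rw [Paper.p, le_div_iff₀ (by linarith)]
    linarith
  set M := max Mv Mw
  have hvI : ∀ t, v t ∈ Set.Icc 0 M := fun t =>
    ⟨ha.le.trans (hva t), (le_abs_self _).trans ((hMv t).trans (le_max_left _ _))⟩
  have hwI : ∀ t, w t ∈ Set.Icc 0 M := fun t =>
    ⟨ha.le.trans (hwa t), (le_abs_self _).trans ((hMw t).trans (le_max_right _ _))⟩
  have hder : ∀ (u : ℝ → ℝ), ContDiff ℝ 4 u → ∀ t₀ k, k < 4 → ∀ t,
      HasDerivAt (fun t => iteratedDeriv k u (t + t₀)) (iteratedDeriv (k + 1) u (t + t₀)) t :=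
    fun u hu t₀ k hk t =>
      (hasDerivAt_iteratedDeriv_of_contDiff (m := 4) hu hk (t + t₀)).comp_add_const t t₀
  have hsub : ∀ k, k < 4 → ∀ t, HasDerivAt
      (fun t => iteratedDeriv k v (t + tv) - iteratedDeriv k w (t + tw))
      (iteratedDeriv (k + 1) v (t + tv) - iteratedDeriv (k + 1) w (t + tw)) t :=
    fun k hk t => (hder v hvreg tv k hk t).sub (hder w hwreg tw k hk t)
  have H : IsForcedSolution ((n : ℝ) / 2) (((n : ℝ) - 4) / 2) (Paper.p n * M ^ (Paper.p n - 1))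
      (fun t => iteratedDeriv 0 v (t + tv) - iteratedDeriv 0 w (t + tw))
      (fun t => iteratedDeriv 1 v (t + tv) - iteratedDeriv 1 w (t + tw))
      (fun t => iteratedDeriv 2 v (t + tv) - iteratedDeriv 2 w (t + tw))
      (fun t => iteratedDeriv 3 v (t + tv) - iteratedDeriv 3 w (t + tw))
      (fun t => v (t + tv) ^ Paper.p n - w (t + tw) ^ Paper.p n) :=
    { deriv_zero := hsub 0 (by norm_num)
      deriv_one := hsub 1 (by norm_num)
      deriv_two := hsub 2 (by norm_num)
      deriv_three := fun t => by
        convert hsub 3 (by norm_num) t using 1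
        have ev := hvode (t + tv)
        have ew := hwode (t + tw)
        rw [Paper.f_eq_of_pos_s2 n (ha.trans_le (hva _)), Paper.A, Paper.B] at ev
        rw [Paper.f_eq_of_pos_s2 n (ha.trans_le (hwa _)), Paper.A, Paper.B] at ew
        simp only [iteratedDeriv_zero]
        linear_combination ew - ev
      nonneg := fun t ht => by
        simp only [iteratedDeriv_zero, sub_nonneg] at ht ⊢
        exact rpow_le_rpow (hwI _).1 ht (by linarith)
      nonpos := fun t ht => by
        simp only [iteratedDeriv_zero, sub_nonpos] at ht ⊢
        exact rpow_le_rpow (hvI _).1 ht (by linarith)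
      abs_le := fun t => by
        simpa only [iteratedDeriv_zero] using rpow_sub_rpow_abs_le hp (hvI _) (hwI _) }
  have hdv : deriv v tv = 0 := IsLocalMin.deriv_eq_zero
    (Eventually.of_forall fun t => htv.trans_le (hva t))
  have hdw : deriv w tw = 0 := IsLocalMin.deriv_eq_zero
    (Eventually.of_forall fun t => htw.trans_le (hwa t))
  refine ⟨tv - tw, fun t => ?_⟩
  have key := H.eq_zero (by linarith) (by simp [htv, htw])
    (by simp [iteratedDeriv_one, hdv, hdw]) (M := M)
    (fun t => by
      have h1 := hvI (t + tv)
      have h2 := hwI (t + tw)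
      rw [iteratedDeriv_zero, iteratedDeriv_zero, abs_le]
      constructor <;> linarith [h1.1, h1.2, h2.1, h2.2]) (t - tw)
  simp only [iteratedDeriv_zero, sub_add_cancel] at key
  rw [show t + (tv - tw) = t - tw + tv by ring]
  linarith
end
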